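/- arXiv:1104.3677 — 9 statements merged into one kernel-verified Lean document; each statement's English description precedes it below -/
import Mathlib

section
/- Let G be a connected graph with a P_ℓ-witness structure {W_1, …, W_ℓ}, and suppose that for some i with 1 ≤ i < ℓ both W_i and W_{i+1} are small, say W_i = {u} and W_{i+1} = {v}. Then uv is a bridge of G, and the two connected components of G − uv have vertex sets W_1 ∪ ⋯ ∪ W_i and W_{i+1} ∪ ⋯ ∪ W_ℓ. -/
open SimpleGraph

/-- An `H`-witness structure of `G`, encoded by the map sending each vertex of `G` to the
vertex of `H` whose witness set contains it. -/
def IsWitnessStructure {V W : Type} (G : SimpleGraph V) (H : SimpleGraph W) (f : V → W) :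
    Prop :=
  Function.Surjective f ∧
  (∀ h : W, (G.induce (f ⁻¹' {h})).Connected) ∧
  ∀ h₁ h₂ : W, h₁ ≠ h₂ → (H.Adj h₁ h₂ ↔ ∃ u v : V, f u = h₁ ∧ f v = h₂ ∧ G.Adj u v)

/-- A set closed under adjacency contains everything reachable from its members. -/
theorem SimpleGraph.Reachable.of_adj_closed {V : Type*} {G : SimpleGraph V} {p : V → Prop}
    (hp : ∀ x y, G.Adj x y → p x → p y) {x y : V} (h : G.Reachable x y) (hx : p x) : p y := by
  obtain ⟨w⟩ := h
  induction w with
  | nil => exact hx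
  | cons hadj _ ih => exact ih (hp _ _ hadj hx)

/-- In a connected graph, after deleting the edge `uv` every vertex is still reachable from one of
its endpoints. -/
theorem SimpleGraph.Connected.reachable_deleteEdges_or {V : Type*} {G : SimpleGraph V}
    (hG : G.Connected) (u v x : V) :
    (G.deleteEdges {s(u, v)}).Reachable u x ∨ (G.deleteEdges {s(u, v)}).Reachable v x := by
  refine (hG.preconnected u x).of_adj_closed
    (p := fun x => (G.deleteEdges {s(u, v)}).Reachable u x ∨
      (G.deleteEdges {s(u, v)}).Reachable v x) (fun x y hxy hx => ?_) (Or.inl .rfl)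
  by_cases he : s(x, y) = s(u, v)
  · rcases Sym2.eq_iff.1 he with ⟨-, rfl⟩ | ⟨-, rfl⟩
    · exact Or.inr .rfl
    · exact Or.inl .rfl
  · have hadj : (G.deleteEdges {s(u, v)}).Adj x y := by
      rw [deleteEdges_adj]
      exact ⟨hxy, he⟩
    exact hx.imp (·.trans hadj.reachable) (·.trans hadj.reachable)

theorem stmt2 {V : Type} [Finite V] (G : SimpleGraph V) (hG : G.Connected)
    (ℓ : ℕ) (f : V → Fin ℓ) (hf : IsWitnessStructure G (SimpleGraph.pathGraph ℓ) f)
    (i : ℕ) (hi : i + 1 < ℓ) (u v : V)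
    (hu : f ⁻¹' {⟨i, Nat.lt_of_succ_lt hi⟩} = {u})
    (hv : f ⁻¹' {⟨i + 1, hi⟩} = {v}) :
    G.IsBridge s(u, v) ∧
    {x : V | (G.deleteEdges {s(u, v)}).Reachable u x} = {x : V | (f x : ℕ) ≤ i} ∧
    {x : V | (G.deleteEdges {s(u, v)}).Reachable v x} = {x : V | i < (f x : ℕ)} := by
  have hfu (x : V) : (f x : ℕ) = i ↔ x = u := by
    simpa [Fin.ext_iff] using Set.ext_iff.1 hu x
  have hfv (x : V) : (f x : ℕ) = i + 1 ↔ x = v := by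
    simpa [Fin.ext_iff] using Set.ext_iff.1 hv x
  have hu' := (hfu u).2 rfl
  have hv' := (hfv v).2 rfl
  have hcross (x y : V) (hxy : G.Adj x y) (hx : (f x : ℕ) ≤ i) (hy : i < (f y : ℕ)) :
      x = u ∧ y = v := by
    have hne : f x ≠ f y := by
      intro h
      rw [h] at hx
      omega
    have h := pathGraph_adj.1 ((hf.2.2 _ _ hne).2 ⟨x, y, rfl, rfl, hxy⟩)
    exact ⟨(hfu x).1 (by omega), (hfv y).1 (by omega)⟩
  have hleft (x : V) (h : (G.deleteEdges {s(u, v)}).Reachable u x) : (f x : ℕ) ≤ i := by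
    refine h.of_adj_closed (p := fun x => (f x : ℕ) ≤ i) (fun x y hxy hx => ?_) hu'.le
    rw [deleteEdges_adj] at hxy
    by_contra! hy
    obtain ⟨rfl, rfl⟩ := hcross x y hxy.1 hx hy
    exact hxy.2 rfl
  have hright (x : V) (h : (G.deleteEdges {s(u, v)}).Reachable v x) : i < (f x : ℕ) := by
    refine h.of_adj_closed (p := fun x => i < (f x : ℕ)) (fun x y hxy hx => ?_) (by omega)
    rw [deleteEdges_adj] at hxy
    by_contra! hy
    obtain ⟨rfl, rfl⟩ := hcross y x hxy.1.symm hy hx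
    exact hxy.2 Sym2.eq_swap
  refine ⟨?_, ?_, ?_⟩
  · refine isBridge_iff.2 fun h => ?_
    have := hleft v h
    omega
  · ext x
    refine ⟨hleft x, fun hx => (hG.reachable_deleteEdges_or u v x).resolve_right fun h => ?_⟩
    exact (hright x h).not_ge hx
  · ext x
    refine ⟨hright x, fun hx => (hG.reachable_deleteEdges_or u v x).resolve_left fun h => ?_⟩
    exact (hleft x h).not_gt hx
end

section
/- Let G be a connected graph and let φ be a 2-coloring of G that is compatible with a P_ℓ-witness structure W = {W_1, …, W_ℓ} of G. Then every monochromatic component of G with respect to φ is a union of consecutive witness sets W_a ∪ W_{a+1} ∪ ⋯ ∪ W_b of W and contains at most one big witness set of W; consequently, the set of monochromatic components of G with respect to φ, ordered according to the indices of the witness sets they contain, is a P_r-witness structure of G for some r ≤ ℓ. -/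
open SimpleGraph

/-- The witness set of `h` is big if it contains at least two vertices. -/
def BigSet {V W : Type} (f : V → W) (h : W) : Prop := 1 < (f ⁻¹' {h}).ncard

/-- A set is monochromatic w.r.t. a 2-coloring if the coloring is constant on it. -/
def Monochromatic {V : Type} (φ : V → Fin 2) (S : Set V) : Prop :=
  ∀ x ∈ S, ∀ y ∈ S, φ x = φ y

/-- A monochromatic component of `G` w.r.t. `φ`: a connected component of the subgraph
induced by one of the color classes, i.e. a maximal monochromatic connected set. -/
def MonoComponent {V : Type} (G : SimpleGraph V) (φ : V → Fin 2) (X : Set V) : Prop :=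
  X.Nonempty ∧ Monochromatic φ X ∧ (G.induce X).Connected ∧
  ∀ Y : Set V, X ⊆ Y → Monochromatic φ Y → (G.induce Y).Connected → Y = X

/-- A 2-coloring `φ` is compatible with the `P_ℓ`-witness structure given by `f`:
every witness set is monochromatic, and consecutive big witness sets (i.e. big witness
sets with only small witness sets in between) receive different colors. -/
def PathCompatible {V : Type} (G : SimpleGraph V) (ℓ : ℕ) (f : V → Fin ℓ)
    (φ : V → Fin 2) : Prop :=
  (∀ x y : V, f x = f y → φ x = φ y) ∧
  ∀ i j : Fin ℓ, i < j → BigSet f i → BigSet f j →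
    (∀ m : Fin ℓ, i < m → m < j → ¬ BigSet f m) →
    ∀ x y : V, f x = i → f y = j → φ x ≠ φ y

/-- The number of indices `k < n` at which the sequence `c` changes its value. -/
noncomputable def changeCount {α : Type} (c : ℕ → α) (n : ℕ) : ℕ :=
  {k | k < n ∧ c k ≠ c (k + 1)}.ncard

lemma changeCount_zero {α : Type} (c : ℕ → α) : changeCount c 0 = 0 := by
  simp [changeCount]

lemma changeCount_succ_of_eq {α : Type} {c : ℕ → α} {n : ℕ} (h : c n = c (n + 1)) :
    changeCount c (n + 1) = changeCount c n := by
  unfold changeCount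
  congr 1
  ext k
  simp only [Set.mem_ofPred_eq]
  constructor
  · rintro ⟨h₁, h₂⟩
    refine ⟨lt_of_le_of_ne (by omega) ?_, h₂⟩
    rintro rfl
    exact h₂ h
  · rintro ⟨h₁, h₂⟩
    exact ⟨by omega, h₂⟩

lemma changeCount_succ_of_ne {α : Type} {c : ℕ → α} {n : ℕ} (h : c n ≠ c (n + 1)) :
    changeCount c (n + 1) = changeCount c n + 1 := by
  unfold changeCount
  have hfin : {k | k < n ∧ c k ≠ c (k + 1)}.Finite :=
    (Set.finite_lt_nat n).subset fun k hk => hk.1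
  rw [← Set.ncard_insert_of_notMem (a := n) (by simp) hfin]
  congr 1
  ext k
  simp only [Set.mem_ofPred_eq, Set.mem_insert_iff]
  constructor
  · rintro ⟨h₁, h₂⟩
    by_cases hk : k = n
    · exact Or.inl hk
    · exact Or.inr ⟨by omega, h₂⟩
  · rintro (rfl | ⟨h₁, h₂⟩)
    · exact ⟨by omega, h⟩
    · exact ⟨by omega, h₂⟩

lemma changeCount_succ_le {α : Type} (c : ℕ → α) (n : ℕ) :
    changeCount c (n + 1) ≤ changeCount c n + 1 := by
  by_cases h : c n = c (n + 1)
  · rw [changeCount_succ_of_eq h]; omega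
  · rw [changeCount_succ_of_ne h]

lemma changeCount_mono {α : Type} (c : ℕ → α) : Monotone (changeCount c) := by
  refine monotone_nat_of_le_succ fun n => ?_
  by_cases h : c n = c (n + 1)
  · rw [changeCount_succ_of_eq h]
  · rw [changeCount_succ_of_ne h]; omega

lemma changeCount_le {α : Type} (c : ℕ → α) (n : ℕ) : changeCount c n ≤ n := by
  induction n with
  | zero => rw [changeCount_zero]
  | succ n ih => have := changeCount_succ_le c n; omega

lemma changeCount_succ_eq_iff {α : Type} {c : ℕ → α} {n : ℕ} :
    changeCount c n = changeCount c (n + 1) ↔ c n = c (n + 1) := by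
  by_cases h : c n = c (n + 1)
  · simp [changeCount_succ_of_eq h, h]
  · simp [changeCount_succ_of_ne h, h]

lemma eq_of_changeCount_eq {α : Type} {c : ℕ → α} {m n : ℕ} (hmn : m ≤ n)
    (h : changeCount c m = changeCount c n) : c m = c n := by
  induction n, hmn using Nat.le_induction with
  | base => rfl
  | succ n hmn ih =>
    have h₁ := changeCount_mono c hmn
    have h₂ := changeCount_mono c (Nat.le_succ n)
    rw [Nat.succ_eq_add_one] at h₂
    rw [ih (by omega), ← changeCount_succ_eq_iff]
    omega

lemma exists_changeCount_jump {α : Type} (c : ℕ → α) {j n : ℕ} (h : j < changeCount c n) :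
    ∃ k < n, changeCount c k = j ∧ changeCount c (k + 1) = j + 1 := by
  induction n with
  | zero => rw [changeCount_zero] at h; omega
  | succ n ih =>
    by_cases hn : j < changeCount c n
    · obtain ⟨k, hk, hk'⟩ := ih hn
      exact ⟨k, by omega, hk'⟩
    · have := changeCount_succ_le c n
      exact ⟨n, by omega, by omega, by omega⟩

lemma exists_changeCount_eq {α : Type} (c : ℕ → α) {j n : ℕ} (h : j ≤ changeCount c n) :
    ∃ k ≤ n, changeCount c k = j := by
  rcases h.lt_or_eq with h | h
  · obtain ⟨k, hk, hk', -⟩ := exists_changeCount_jump c h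
    exact ⟨k, hk.le, hk'⟩
  · exact ⟨n, le_rfl, h.symm⟩

lemma IsWitnessStructure.val_eq_or_of_adj {V : Type} {G : SimpleGraph V} {ℓ : ℕ}
    {f : V → Fin ℓ} (hf : IsWitnessStructure G (pathGraph ℓ) f) {u v : V} (h : G.Adj u v) :
    (f u : ℕ) = f v ∨ (f u : ℕ) + 1 = f v ∨ (f v : ℕ) + 1 = f u := by
  by_cases huv : f u = f v
  · exact Or.inl (congrArg _ huv)
  · exact Or.inr (pathGraph_adj.1 ((hf.2.2 _ _ huv).2 ⟨u, v, rfl, rfl, h⟩))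

lemma IsWitnessStructure.exists_adj {V : Type} {G : SimpleGraph V} {ℓ : ℕ}
    {f : V → Fin ℓ} (hf : IsWitnessStructure G (pathGraph ℓ) f) {k : ℕ} (hk : k + 1 < ℓ) :
    ∃ u v : V, (f u : ℕ) = k ∧ (f v : ℕ) = k + 1 ∧ G.Adj u v := by
  have hadj : (pathGraph ℓ).Adj ⟨k, by omega⟩ ⟨k + 1, hk⟩ := pathGraph_adj.2 (Or.inl rfl)
  obtain ⟨u, v, hu, hv, huv⟩ := (hf.2.2 _ _ hadj.ne).1 hadj
  exact ⟨u, v, by simp [hu], by simp [hv], huv⟩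

/-- A set that is a union of consecutive witness sets of a path witness structure is
connected. -/
lemma IsWitnessStructure.connected_induce {V : Type} {G : SimpleGraph V} {ℓ : ℕ}
    {f : V → Fin ℓ} (hf : IsWitnessStructure G (pathGraph ℓ) f) {S : Set V}
    (hne : S.Nonempty)
    (hS : ∀ x ∈ S, ∀ y ∈ S, ∀ z, f x ≤ f z → f z ≤ f y → z ∈ S) :
    (G.induce S).Connected := by
  have key : ∀ (d : ℕ) (x y : S), (f x : ℕ) + d = f y → (G.induce S).Reachable x y := by
    intro d
    induction d with
    | zero =>
      intro x y hxy
      have hxy' : f x = f y := Fin.ext hxy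
      have hsub : f ⁻¹' {f x} ⊆ S := fun z (hz : f z = f x) =>
        hS x x.2 x x.2 z hz.ge hz.le
      exact ((hf.2.1 (f x)).preconnected ⟨x, rfl⟩ ⟨y, hxy'.symm⟩).map
        (SimpleGraph.induceHomOfLE G hsub).toHom
    | succ d ih =>
      intro x y hxy
      obtain ⟨u, v, hu, hv, huv⟩ := hf.exists_adj (k := (f x : ℕ) + d)
        (by have := (f y).2; omega)
      have huS : u ∈ S := hS x x.2 y y.2 u (Fin.le_def.2 (by omega)) (Fin.le_def.2 (by omega))
      have hvS : v ∈ S := hS x x.2 y y.2 v (Fin.le_def.2 (by omega)) (Fin.le_def.2 (by omega))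
      have hvy : f v = f y := Fin.ext (by omega)
      have hsub : f ⁻¹' {f y} ⊆ S := fun z (hz : f z = f y) =>
        hS y y.2 y y.2 z hz.ge hz.le
      have h₁ : (G.induce S).Adj ⟨u, huS⟩ ⟨v, hvS⟩ := huv
      exact ((ih x ⟨u, huS⟩ hu.symm).trans h₁.reachable).trans
        (((hf.2.1 (f y)).preconnected ⟨v, hvy⟩ ⟨y, rfl⟩).map
          (SimpleGraph.induceHomOfLE G hsub).toHom)
  have : Nonempty S := hne.to_subtype
  refine ⟨fun x y => ?_⟩
  rcases le_total (f x : ℕ) (f y) with h | h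
  · exact key _ x y (Nat.add_sub_cancel' h)
  · exact (key _ y x (Nat.add_sub_cancel' h)).symm

lemma eq_of_connected_induce {V β : Type} {G : SimpleGraph V} {S : Set V} (g : V → β)
    (hS : (G.induce S).Connected) (hg : ∀ x ∈ S, ∀ y ∈ S, G.Adj x y → g x = g y)
    {x y : V} (hx : x ∈ S) (hy : y ∈ S) : g x = g y := by
  obtain ⟨w⟩ := hS.preconnected ⟨x, hx⟩ ⟨y, hy⟩
  have key : ∀ (a b : S), (G.induce S).Walk a b → g a = g b := by
    intro a b w
    induction w with
    | nil => rfl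
    | cons h _ ih => exact (hg _ (Subtype.coe_prop _) _ (Subtype.coe_prop _) h).trans ih
  exact key _ _ w

/-- If a map with monochromatic connected fibers separates the endpoints of every
non-monochromatic edge and no others, its fibers are the monochromatic components. -/
lemma monoComponent_iff_of_fibers {V β : Type} {G : SimpleGraph V} {φ : V → Fin 2} {g : V → β}
    (hsurj : Function.Surjective g) (hmono : ∀ j, Monochromatic φ (g ⁻¹' {j}))
    (hconn : ∀ j, (G.induce (g ⁻¹' {j})).Connected)
    (hedge : ∀ x y, G.Adj x y → φ x = φ y → g x = g y) (X : Set V) :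
    MonoComponent G φ X ↔ ∃ j, X = g ⁻¹' {j} := by
  have hconst : ∀ Y : Set V, Monochromatic φ Y → (G.induce Y).Connected → ∀ x ∈ Y,
      Y ⊆ g ⁻¹' {g x} := fun Y hY hYc x hx y hy =>
    eq_of_connected_induce g hYc (fun a ha b hb hab => hedge a b hab (hY a ha b hb)) hy hx
  constructor
  · rintro ⟨⟨x, hx⟩, hX, hXc, hmax⟩
    exact ⟨g x, (hmax _ (hconst X hX hXc x hx) (hmono _) (hconn _)).symm⟩
  · rintro ⟨j, rfl⟩
    obtain ⟨x, rfl⟩ := hsurj j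
    exact ⟨⟨x, rfl⟩, hmono _, hconn _, fun Y hY hYm hYc =>
      (hconst Y hYm hYc x (hY rfl)).antisymm hY⟩

/-- Compatible colorings admit at most one big witness set in a monochromatic union of
consecutive witness sets. -/
lemma PathCompatible.not_lt_of_bigSet {V : Type} {G : SimpleGraph V} {ℓ : ℕ} {f : V → Fin ℓ}
    {φ : V → Fin 2} (hφ : PathCompatible G ℓ f φ) (hsurj : Function.Surjective f)
    {X : Set V} (hX : Monochromatic φ X) {a b : Fin ℓ} (hab : X = {x | a ≤ f x ∧ f x ≤ b})
    {i j : Fin ℓ} (hi : BigSet f i) (hj : BigSet f j) (hiX : f ⁻¹' {i} ⊆ X)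
    (hjX : f ⁻¹' {j} ⊆ X) : ¬ i < j := by
  intro hij
  obtain ⟨m, ⟨him, hm⟩, hmin⟩ :=
    Set.exists_min_image {m | i < m ∧ BigSet f m} id (Set.toFinite _) ⟨j, hij, hj⟩
  obtain ⟨x, hx⟩ := hsurj i
  obtain ⟨y, hy⟩ := hsurj m
  obtain ⟨z, hz⟩ := hsurj j
  have hxX : x ∈ X := hiX hx
  have hzX : z ∈ X := hjX hz
  have hmj : m ≤ j := hmin j ⟨hij, hj⟩
  have hyX : y ∈ X := by
    rw [hab] at hxX hzX ⊢
    exact ⟨hxX.1.trans (by rw [hx, hy]; exact him.le), le_trans (by rw [hy, hz]; exact hmj) hzX.2⟩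
  exact hφ.2 i m him hi hm (fun k hik hkm hk => (hmin k ⟨hik, hk⟩).not_gt hkm) x y hx hy
    (hX x hxX y hyX)

theorem stmt5 {V : Type} [Finite V] (G : SimpleGraph V) (hG : G.Connected)
    (ℓ : ℕ) (f : V → Fin ℓ) (hf : IsWitnessStructure G (SimpleGraph.pathGraph ℓ) f)
    (φ : V → Fin 2) (hφ : PathCompatible G ℓ f φ) :
    (∀ X : Set V, MonoComponent G φ X →
      (∃ a b : Fin ℓ, a ≤ b ∧ X = {x : V | a ≤ f x ∧ f x ≤ b}) ∧
      (∀ i j : Fin ℓ, BigSet f i → BigSet f j → f ⁻¹' {i} ⊆ X → f ⁻¹' {j} ⊆ X → i = j)) ∧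
    ∃ (r : ℕ) (g : V → Fin r), r ≤ ℓ ∧
      IsWitnessStructure G (SimpleGraph.pathGraph r) g ∧
      (∀ X : Set V, MonoComponent G φ X ↔ ∃ j : Fin r, X = g ⁻¹' {j}) ∧
      ∀ x y : V, f x ≤ f y → g x ≤ g y := by
  have hcol := hφ.1
  obtain ⟨v₀⟩ := hG.nonempty
  obtain ⟨c, hc⟩ : ∃ c : ℕ → Fin 2, ∀ x, φ x = c (f x) := by
    choose s hs using hf.1
    refine ⟨fun k => if h : k < ℓ then φ (s ⟨k, h⟩) else 0, fun x => ?_⟩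
    simp only [Fin.is_lt, dite_true]
    exact hcol _ _ (hs _).symm
  have hpos : 0 < ℓ := (f v₀).pos
  have hmonoc := changeCount_mono c
  let g : V → Fin (changeCount c (ℓ - 1) + 1) := fun x =>
    ⟨changeCount c (f x), Nat.lt_succ_of_le (hmonoc (by have := (f x).2; omega))⟩
  have hgval : ∀ x, (g x : ℕ) = changeCount c (f x) := fun x => rfl
  have hgmono : ∀ x y, f x ≤ f y → g x ≤ g y := fun x y h => Fin.le_def.2 (hmonoc h)
  have hgsurj : Function.Surjective g := by
    intro j
    obtain ⟨k, hk, hkj⟩ := exists_changeCount_eq c (Nat.le_of_lt_succ j.2)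
    obtain ⟨x, hx⟩ := hf.1 ⟨k, by omega⟩
    exact ⟨x, Fin.ext (by rw [hgval, hx]; exact hkj)⟩
  have hmono : ∀ j, Monochromatic φ (g ⁻¹' {j}) := by
    intro j x hx y hy
    have hxy : changeCount c (f x) = changeCount c (f y) := by
      rw [← hgval, ← hgval, show g x = j from hx, show g y = j from hy]
    rw [hc, hc]
    rcases le_total (f x : ℕ) (f y) with h | h
    · exact eq_of_changeCount_eq h hxy
    · exact (eq_of_changeCount_eq h hxy.symm).symm
  have hconn : ∀ j, (G.induce (g ⁻¹' {j})).Connected := by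
    intro j
    refine hf.connected_induce (hgsurj j) ?_
    rintro x rfl y hy z hxz hzy
    exact ((hgmono _ _ hzy).trans (le_of_eq hy)).antisymm (hgmono _ _ hxz)
  have hedge : ∀ x y, G.Adj x y → φ x = φ y → g x = g y := by
    intro x y hxy h
    rw [hc, hc] at h
    refine Fin.ext ?_
    rw [hgval, hgval]
    rcases hf.val_eq_or_of_adj hxy with h' | h' | h'
    · rw [h']
    · rw [← h'] at h ⊢
      exact changeCount_succ_eq_iff.2 h
    · rw [← h'] at h ⊢
      exact (changeCount_succ_eq_iff.2 h.symm).symm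
  have hcomp := monoComponent_iff_of_fibers hgsurj hmono hconn hedge
  refine ⟨fun X hX => ?_, _, g, ?_, ⟨hgsurj, hconn, fun h₁ h₂ hne => ?_⟩, hcomp, hgmono⟩
  · obtain ⟨j, hj⟩ := (hcomp X).1 hX
    obtain ⟨p, hp, hpmin⟩ := Set.exists_min_image X f (Set.toFinite _) hX.1
    obtain ⟨q, hq, hqmax⟩ := Set.exists_max_image X f (Set.toFinite _) hX.1
    have hab : X = {x | f p ≤ f x ∧ f x ≤ f q} := by
      refine Set.Subset.antisymm (fun x hx => ⟨hpmin x hx, hqmax x hx⟩) ?_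
      rintro x ⟨hpx, hxq⟩
      rw [hj] at hp hq ⊢
      exact ((hgmono _ _ hxq).trans (le_of_eq hq)).antisymm
        ((le_of_eq (Eq.symm hp)).trans (hgmono _ _ hpx))
    refine ⟨⟨f p, f q, hpmin q hq, hab⟩, fun i k hi hk hiX hkX => ?_⟩
    exact le_antisymm (not_lt.1 (hφ.not_lt_of_bigSet hf.1 hX.2.1 hab hk hi hkX hiX))
      (not_lt.1 (hφ.not_lt_of_bigSet hf.1 hX.2.1 hab hi hk hiX hkX))
  · have := changeCount_le c (ℓ - 1)
    omega
  · have hjump : ∀ i j : Fin (changeCount c (ℓ - 1) + 1), (i : ℕ) + 1 = j →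
        ∃ u v, g u = i ∧ g v = j ∧ G.Adj u v := by
      intro i j hij
      obtain ⟨k, hk, hki, hkj⟩ :=
        exists_changeCount_jump c (j := i) (n := ℓ - 1) (by have := j.2; omega)
      obtain ⟨u, v, hu, hv, huv⟩ := hf.exists_adj (k := k) (by omega)
      exact ⟨u, v, Fin.ext (by rw [hgval, hu, hki]), Fin.ext (by rw [hgval, hv, hkj, hij]), huv⟩
    rw [pathGraph_adj]
    constructor
    · rintro (h | h)
      · exact hjump _ _ h
      · obtain ⟨u, v, hu, hv, huv⟩ := hjump _ _ h
        exact ⟨v, u, hv, hu, huv.symm⟩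
    · rintro ⟨u, v, rfl, rfl, huv⟩
      have hne' : changeCount c (f u) ≠ changeCount c (f v) := fun h => hne (Fin.ext h)
      rw [hgval, hgval]
      rcases hf.val_eq_or_of_adj huv with h | h | h
      · exact absurd (by rw [h]) hne'
      · have h₁ := changeCount_succ_le c (f u)
        have h₂ := hmonoc (Nat.le_succ (f u : ℕ))
        rw [Nat.succ_eq_add_one, h] at h₂
        rw [h] at h₁
        omega
      · have h₁ := changeCount_succ_le c (f v)
        have h₂ := hmonoc (Nat.le_succ (f v : ℕ))
        rw [Nat.succ_eq_add_one, h] at h₂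
        rw [h] at h₁
        omega
end

section
/- Let G be a graph on n vertices that is k-contractible to the path P_ℓ, and let W = {W_1, …, W_ℓ} be a P_ℓ-witness structure of G with |V(G)| − ℓ ≤ k. Then there exists a 2-coloring ψ of G compatible with W such that every 2-coloring of G that coincides with ψ on all vertices belonging to big witness sets of W is also compatible with W; consequently, the number of 2-colorings of G compatible with W is at least 2^{n−2k}. -/
open SimpleGraph

open Classical in
/-- The color of `x` is the parity of the number of big witness sets preceding that of `x`. -/
noncomputable def parityColoring {V : Type} {ℓ : ℕ} (f : V → Fin ℓ) (x : V) : Fin 2 :=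
  Fin.ofNat 2 (Finset.univ.filter fun m : Fin ℓ => BigSet f m ∧ m < f x).card

lemma pathCompatible_parityColoring {V : Type} (G : SimpleGraph V) (ℓ : ℕ) (f : V → Fin ℓ) :
    PathCompatible G ℓ f (parityColoring f) := by
  classical
  refine ⟨fun x y h => by simp only [parityColoring, h], ?_⟩
  rintro i j hij hi hj hm x y rfl rfl h
  have hins : (Finset.univ.filter fun m : Fin ℓ => BigSet f m ∧ m < f y) =
      insert (f x) (Finset.univ.filter fun m : Fin ℓ => BigSet f m ∧ m < f x) := by
    ext m
    simp only [Finset.mem_filter, Finset.mem_univ, true_and, Finset.mem_insert]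
    constructor
    · rintro ⟨hb, hlt⟩
      rcases lt_trichotomy m (f x) with h' | h' | h'
      · exact Or.inr ⟨hb, h'⟩
      · exact Or.inl h'
      · exact absurd hb (hm m h' hlt)
    · rintro (rfl | ⟨hb, hlt⟩)
      · exact ⟨hi, hij⟩
      · exact ⟨hb, hlt.trans hij⟩
  have hval := congrArg Fin.val h
  simp only [parityColoring, hins, Fin.ofNat] at hval
  rw [Finset.card_insert_of_notMem (by simp)] at hval
  omega

lemma eq_of_not_bigSet {V W : Type} [Finite V] {f : V → W} {x y : V}
    (hx : ¬ BigSet f (f x)) (h : f x = f y) : x = y :=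
  (Set.ncard_le_one_iff (Set.toFinite _)).1 (not_lt.1 hx) rfl h.symm

lemma PathCompatible.of_eq_on_bigSet {V : Type} [Finite V] {G : SimpleGraph V} {ℓ : ℕ}
    {f : V → Fin ℓ} {φ ψ : V → Fin 2} (hψ : PathCompatible G ℓ f ψ)
    (h : ∀ x : V, BigSet f (f x) → φ x = ψ x) : PathCompatible G ℓ f φ := by
  refine ⟨fun x y hxy => ?_, ?_⟩
  · by_cases hx : BigSet f (f x)
    · rw [h x hx, h y (hxy ▸ hx), hψ.1 x y hxy]
    · rw [eq_of_not_bigSet hx hxy]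
  · rintro i j hij hi hj hm x y rfl rfl
    rw [h x hi, h y hj]
    exact hψ.2 _ _ hij hi hj hm x y rfl rfl

open Classical in
/-- A big set of size `w` accounts for `w - 1 ≥ w / 2` of the lost vertices. -/
lemma card_bigSet_add_le {V W : Type} [Fintype V] [Fintype W] {f : V → W}
    (hf : Function.Surjective f) :
    (Finset.univ.filter fun x : V => BigSet f (f x)).card + 2 * Fintype.card W ≤
      2 * Fintype.card V := by
  have hB := Finset.card_eq_sum_card_fiberwise (f := f)
    (s := Finset.univ.filter fun x : V => BigSet f (f x)) (t := Finset.univ) (by simp)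
  have hV := Finset.card_eq_sum_card_fiberwise (f := f)
    (s := (Finset.univ : Finset V)) (t := Finset.univ) (by simp)
  have hW : 2 * Fintype.card W = ∑ _h : W, 2 := by simp [mul_comm]
  rw [Finset.card_univ] at hV
  rw [hB, hV, hW, ← Finset.sum_add_distrib,
    Finset.mul_sum]
  refine Finset.sum_le_sum fun h _ => ?_
  have hw : (f ⁻¹' {h}).ncard = (Finset.univ.filter fun x : V => f x = h).card := by
    rw [← Set.ncard_coe_finset]
    congr 1
    ext x
    simp
  by_cases hb : BigSet f h
  · have hle := Finset.card_le_card (Finset.filter_subset_filter (fun x : V => f x = h)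
      (Finset.filter_subset (fun x : V => BigSet f (f x)) Finset.univ))
    unfold BigSet at hb
    omega
  · have hempty : ((Finset.univ.filter fun x : V => BigSet f (f x)).filter
        fun x => f x = h) = ∅ := by
      ext x
      simp only [Finset.mem_filter, Finset.mem_univ, true_and, Finset.notMem_empty, iff_false]
      rintro ⟨hx, rfl⟩
      exact hb hx
    obtain ⟨x, hx⟩ := hf h
    have hpos : 0 < (Finset.univ.filter fun x : V => f x = h).card :=
      Finset.card_pos.2 ⟨x, by simpa using hx⟩
    rw [hempty, Finset.card_empty]
    omega

lemma two_pow_le_ncard_eq_on {V : Type} [Fintype V] (p : V → Prop) [DecidablePred p]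
    (ψ : V → Fin 2) :
    2 ^ (Fintype.card V - (Finset.univ.filter p).card) ≤
      {φ : V → Fin 2 | ∀ x, p x → φ x = ψ x}.ncard := by
  classical
  let e : ({x // ¬ p x} → Fin 2) → {φ : V → Fin 2 | ∀ x, p x → φ x = ψ x} := fun g =>
    ⟨fun x => if hx : p x then ψ x else g ⟨x, hx⟩, fun x hx => dif_pos hx⟩
  have he : Function.Injective e := by
    intro g g' h
    funext x
    simpa [e, x.2] using congrFun (congrArg Subtype.val h) x.1
  have hcard := Nat.card_le_card_of_injective e he
  rwa [Nat.card_eq_fintype_card, Fintype.card_fun, Fintype.card_fin,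
    Fintype.card_subtype_compl, Fintype.card_subtype, Nat.card_coe_set_eq] at hcard

theorem stmt6 {V : Type} [Finite V] (G : SimpleGraph V) (k ℓ : ℕ)
    (f : V → Fin ℓ) (hf : IsWitnessStructure G (SimpleGraph.pathGraph ℓ) f)
    (hk : Nat.card V - ℓ ≤ k) :
    ∃ ψ : V → Fin 2, PathCompatible G ℓ f ψ ∧
      (∀ φ : V → Fin 2, (∀ x : V, BigSet f (f x) → φ x = ψ x) →
        PathCompatible G ℓ f φ) ∧
      2 ^ (Nat.card V - 2 * k) ≤ {φ : V → Fin 2 | PathCompatible G ℓ f φ}.ncard := by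
  classical
  have := Fintype.ofFinite V
  have hψ := pathCompatible_parityColoring G ℓ f
  refine ⟨parityColoring f, hψ, fun φ h => hψ.of_eq_on_bigSet h, ?_⟩
  refine le_trans ?_ ((two_pow_le_ncard_eq_on (fun x => BigSet f (f x))
    (parityColoring f)).trans
    (Set.ncard_le_ncard (fun φ h => hψ.of_eq_on_bigSet h) (Set.toFinite _)))
  have hB := card_bigSet_add_le hf.1
  rw [Nat.card_eq_fintype_card] at hk ⊢
  rw [Fintype.card_fin] at hB
  exact Nat.pow_le_pow_right two_pos (by omega)
end

section
/- Let G be a connected graph, let v be a cut vertex of G, let V_1, …, V_p be the vertex sets of the connected components of G − v, and for each i let G_i be the subgraph of G induced by V_i ∪ {v}. Then G is k-contractible to a tree if and only if there exist nonnegative integers k_1, …, k_p with k_1 + ⋯ + k_p ≤ k such that G_i is k_i-contractible to a tree for every i ∈ {1, …, p}. -/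
open SimpleGraph

/-- `G` is `k`-contractible to `H`. -/
def KContractible {V W : Type} (G : SimpleGraph V) (H : SimpleGraph W) (k : ℕ) : Prop :=
  (∃ f : V → W, IsWitnessStructure G H f) ∧ Nat.card V - Nat.card W ≤ k

/-- `G` is `k`-contractible to a tree (a connected acyclic graph). -/
def KContractibleToTree {V : Type} (G : SimpleGraph V) (k : ℕ) : Prop :=
  ∃ (n : ℕ) (T : SimpleGraph (Fin n)), T.IsTree ∧ KContractible G T k

namespace SimpleGraph

variable {V W ι : Type} {G : SimpleGraph V}

lemma Reachable.lift {H : SimpleGraph W} (φ : V → W)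
    (h : ∀ a b, G.Adj a b → H.Reachable (φ a) (φ b)) {x y : V} (hxy : G.Reachable x y) :
    H.Reachable (φ x) (φ y) := by
  obtain ⟨p⟩ := hxy
  induction p with
  | nil => rfl
  | cons hadj _ ih => exact (h _ _ hadj).trans ih

lemma Reachable.closed {P : V → Prop} (hP : ∀ a b, G.Adj a b → P a → P b) {x y : V}
    (hxy : G.Reachable x y) (hx : P x) : P y := by
  obtain ⟨p⟩ := hxy
  induction p with
  | nil => exact hx
  | cons hadj _ ih => exact ih (hP _ _ hadj hx)

/-- A graph is acyclic if each of its edges survives in some acyclic image in which no other edge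
is identified with it; the map to the image may collapse edges to vertices. -/
lemma isAcyclic_of_forall_adj_exists_image {T : SimpleGraph W}
    (h : ∀ a b, T.Adj a b → ∃ (X : Type) (T' : SimpleGraph X) (φ : W → X),
      T'.IsAcyclic ∧ T'.Adj (φ a) (φ b) ∧ ∀ c d, T.Adj c d → φ c = φ d ∨
        (T'.Adj (φ c) (φ d) ∧ (s(φ c, φ d) = s(φ a, φ b) → s(c, d) = s(a, b)))) :
    T.IsAcyclic := by
  rw [isAcyclic_iff_forall_adj_isBridge]
  intro a b hab
  obtain ⟨X, T', φ, hT', hφ, hedge⟩ := h a b hab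
  rw [isBridge_iff]
  intro hr
  refine (isBridge_iff.1 (isAcyclic_iff_forall_adj_isBridge.1 hT' hφ)) (hr.lift φ ?_)
  intro c d hcd
  rw [deleteEdges_adj] at hcd
  rcases hedge c d hcd.1 with heq | ⟨hadj, hinj⟩
  · rw [heq]
  · exact Adj.reachable (deleteEdges_adj.2 ⟨hadj, fun hs ↦ hcd.2 (hinj hs)⟩)

/-- The subgraph of edges whose ends have the same image under `f`. -/
def fiberGraph (G : SimpleGraph V) (f : V → W) : SimpleGraph V where
  Adj a b := G.Adj a b ∧ f a = f b
  symm.symm _ _ h := ⟨h.1.symm, h.2.symm⟩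

/-- `f` has connected fibres, and contracting them turns `G` into a forest. -/
structure IsForestContraction (G : SimpleGraph V) (f : V → W) : Prop where
  reachable : ∀ x y, f x = f y → (G.fiberGraph f).Reachable x y
  isAcyclic : (G.map f).IsAcyclic

lemma reachable_induce_fiber {f : V → W} {x y : V} (h : (G.fiberGraph f).Reachable x y) :
    ∀ (w : W) (hx : f x = w) (hy : f y = w),
      (G.induce (f ⁻¹' {w})).Reachable ⟨x, hx⟩ ⟨y, hy⟩ := by
  obtain ⟨p⟩ := h
  induction p with
  | nil => intro w hx hy; rfl
  | cons hadj _ ih =>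
    intro w hx hy
    have hadj' : (G.induce (f ⁻¹' {w})).Adj ⟨_, hx⟩ ⟨_, hadj.2.symm.trans hx⟩ := hadj.1
    exact hadj'.reachable.trans (ih w _ hy)

lemma IsForestContraction.kContractibleToTree [Finite V] {f : V → W} {k : ℕ}
    (hf : G.IsForestContraction f) (hG : G.Connected)
    (hk : Nat.card V ≤ (Set.range f).ncard + k) : KContractibleToTree G k := by
  obtain ⟨n, ⟨e⟩⟩ := Finite.exists_equiv_fin (Set.range f)
  set g : V → Fin n := fun x ↦ e ⟨f x, x, rfl⟩ with hg
  have hgf : ∀ x, ((e.symm (g x) : Set.range f) : W) = f x := fun x ↦ by simp [hg]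
  have hsurj : Function.Surjective g := by
    intro a
    obtain ⟨x, hx⟩ := (e.symm a).2
    exact ⟨x, by rw [hg]; simp [hx]⟩
  have hfg : ∀ {x y}, g x = g y ↔ f x = f y := e.injective.eq_iff.trans Subtype.ext_iff
  have hfib : G.fiberGraph g = G.fiberGraph f := by
    ext a b
    simp only [fiberGraph, hfg]
  let φ : G.map g →g G.map f :=
    { toFun := fun a ↦ e.symm a
      map_rel' := by
        rintro a b ⟨hne, x, y, hxy, rfl, rfl⟩
        simp only [hgf]
        exact map_adj_apply' hxy (fun h ↦ hne (hfg.2 h)) }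
  have hφ : Function.Injective φ := Subtype.val_injective.comp e.symm.injective
  have hconn : (G.map g).Connected := by
    have := hG.nonempty
    have : Nonempty (Fin n) := Nonempty.map g ‹_›
    refine ⟨fun a b ↦ ?_⟩
    obtain ⟨x, rfl⟩ := hsurj a
    obtain ⟨y, rfl⟩ := hsurj b
    refine (hG.preconnected x y).lift g fun c d hcd ↦ ?_
    by_cases h : g c = g d
    · rw [h]
    · exact Adj.reachable (map_adj_apply' hcd h)
  refine ⟨n, G.map g, ⟨hconn, hf.isAcyclic.comap φ hφ⟩, ⟨g, hsurj, ?_, ?_⟩, ?_⟩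
  · intro a
    obtain ⟨x, rfl⟩ := hsurj a
    have : Nonempty (g ⁻¹' {g x}) := ⟨⟨x, rfl⟩⟩
    refine ⟨fun y z ↦ reachable_induce_fiber (x := y.1) (y := z.1) ?_ _ y.2 z.2⟩
    rw [hfib]
    exact hf.reachable _ _ (hfg.1 (y.2.trans z.2.symm))
  · intro a b hab
    rw [map_adj']
    constructor
    · rintro ⟨-, x, y, h, hx, hy⟩; exact ⟨x, y, hx, hy, h⟩
    · rintro ⟨x, y, hx, hy, h⟩; exact ⟨hab, x, y, h, hx, hy⟩
  · have : (Set.range f).ncard = n := by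
      rw [← Nat.card_coe_set_eq, Nat.card_congr e, Nat.card_fin]
    rw [Nat.card_fin]
    omega

lemma exists_isForestContraction {k : ℕ} (h : KContractibleToTree G k) :
    ∃ (n : ℕ) (f : V → Fin n), G.IsForestContraction f ∧
      Nat.card V ≤ (Set.range f).ncard + k := by
  obtain ⟨n, T, hT, ⟨f, hsurj, hconn, hadj⟩, hk⟩ := h
  refine ⟨n, f, ⟨fun x y hxy ↦ ?_, ?_⟩, ?_⟩
  · exact ((hconn (f y)).preconnected ⟨x, hxy⟩ ⟨y, rfl⟩).lift Subtype.val fun a b hab ↦ by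
      exact Adj.reachable ⟨hab, a.2.trans b.2.symm⟩
  · have hle : G.map f ≤ T := by
      rintro a b ⟨hne, x, y, hxy, hx, hy⟩
      exact (hadj a b hne).2 ⟨x, y, hx, hy, hxy⟩
    exact hT.isAcyclic.comap (Hom.ofLE hle) Function.injective_id
  · rw [hsurj.range_eq, Set.ncard_univ]
    omega

/-- `G` is the union of the subgraphs induced by the sets `S i`, any two of which share
only the vertex `v`. -/
structure IsVertexSum (G : SimpleGraph V) (v : V) (S : ι → Set V) : Prop where
  mem : ∀ i, v ∈ S i
  cover : ∀ x, x = v ∨ ∃ i, x ∈ S i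
  eq_of_mem : ∀ {i j x}, i ≠ j → x ∈ S i → x ∈ S j → x = v
  adj : ∀ {x y}, G.Adj x y → ∃ i, x ∈ S i ∧ y ∈ S i

namespace IsVertexSum

variable {v : V} {S : ι → Set V} (hS : G.IsVertexSum v S)

include hS in
lemma range_eq (g : V → W) : Set.range g = insert (g v) (⋃ i, g '' S i \ {g v}) := by
  ext w
  simp only [Set.mem_range, Set.mem_insert_iff, Set.mem_iUnion, Set.mem_sdiff, Set.mem_image,
    Set.mem_singleton_iff]
  constructor
  · rintro ⟨x, rfl⟩
    by_cases hx : g x = g v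
    · exact Or.inl hx
    · rcases hS.cover x with rfl | ⟨i, hi⟩
      · exact Or.inl rfl
      · exact Or.inr ⟨i, ⟨x, hi, rfl⟩, hx⟩
  · rintro (rfl | ⟨i, ⟨x, -, rfl⟩, -⟩) <;> exact ⟨_, rfl⟩

include hS in
lemma ncard_range [Finite V] [Finite ι] (g : V → W)
    (hg : ∀ i j x y, i ≠ j → x ∈ S i → y ∈ S j → g x = g y → g x = g v) :
    (Set.range g).ncard = 1 + ∑ᶠ i, ((g '' S i).ncard - 1) := by
  have hfin : ∀ i, (g '' S i \ {g v}).Finite := fun i ↦ ((Set.toFinite _).image _).sdiff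
  rw [hS.range_eq g, Set.ncard_insert_of_notMem (by simp) (Set.finite_iUnion hfin),
    Set.ncard_iUnion_of_finite hfin, add_comm]
  · congr 1
    exact finsum_congr fun i ↦ Set.ncard_sdiff_singleton_of_mem ⟨v, hS.mem i, rfl⟩
  · intro i j hij
    refine Set.disjoint_left.2 ?_
    rintro _ ⟨⟨x, hx, rfl⟩, hne⟩ ⟨⟨y, hy, hyx⟩, -⟩
    exact hne (hg i j x y hij hx hy hyx.symm)

include hS in
lemma card_eq [Finite V] [Finite ι] : Nat.card V = 1 + ∑ᶠ i, ((S i).ncard - 1) := by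
  have := hS.ncard_range (id : V → V) (by
    rintro i j x y hij hx hy rfl
    exact hS.eq_of_mem hij hx hy)
  simpa using this

open Classical in
/-- The map fixing `S i` and collapsing all other vertices to `v`. -/
noncomputable def retract (i : ι) (x : V) : S i :=
  if h : x ∈ S i then ⟨x, h⟩ else ⟨v, hS.mem i⟩

lemma retract_of_mem {i : ι} {x : V} (h : x ∈ S i) : hS.retract i x = ⟨x, h⟩ := dif_pos h

lemma retract_of_notMem {i : ι} {x : V} (h : x ∉ S i) : hS.retract i x = ⟨v, hS.mem i⟩ := dif_neg h

lemma retract_of_ne {i j : ι} (hij : i ≠ j) {x : V} (h : x ∈ S j) :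
    hS.retract i x = ⟨v, hS.mem i⟩ := by
  by_cases hi : x ∈ S i
  · rw [hS.retract_of_mem hi]
    exact Subtype.ext (hS.eq_of_mem hij hi h)
  · exact hS.retract_of_notMem hi

lemma retract_adj (i : ι) {x y : V} (h : G.Adj x y) :
    hS.retract i x = hS.retract i y ∨ (x ∈ S i ∧ y ∈ S i) := by
  obtain ⟨j, hx, hy⟩ := hS.adj h
  by_cases hij : i = j
  · exact Or.inr (hij ▸ ⟨hx, hy⟩)
  · exact Or.inl (by rw [hS.retract_of_ne hij hx, hS.retract_of_ne hij hy])

include hS in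
lemma connected_induce (hG : G.Connected) (i : ι) : (G.induce (S i)).Connected := by
  have : Nonempty (S i) := ⟨⟨v, hS.mem i⟩⟩
  refine ⟨fun x y ↦ ?_⟩
  have h := (hG.preconnected x y).lift (H := G.induce (S i)) (hS.retract i) fun a b hab ↦ by
    rcases hS.retract_adj i hab with h | ⟨ha, hb⟩
    · rw [h]
    · rw [hS.retract_of_mem ha, hS.retract_of_mem hb]
      exact Adj.reachable hab
  rwa [hS.retract_of_mem x.2, hS.retract_of_mem y.2] at h

include hS in
lemma isForestContraction_restrict {f : V → W} (hf : G.IsForestContraction f) (i : ι) :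
    (G.induce (S i)).IsForestContraction (fun x : S i ↦ f x) := by
  refine ⟨fun x y hxy ↦ ?_, ?_⟩
  · have h := (hf.reachable x y hxy).lift
      (H := (G.induce (S i)).fiberGraph (fun x : S i ↦ f x)) (hS.retract i) fun a b hab ↦ by
        rcases hS.retract_adj i hab.1 with h | ⟨ha, hb⟩
        · rw [h]
        · rw [hS.retract_of_mem ha, hS.retract_of_mem hb]
          exact Adj.reachable hab
    rwa [hS.retract_of_mem x.2, hS.retract_of_mem y.2] at h
  · have hle : (G.induce (S i)).map (fun x : S i ↦ f x) ≤ G.map f := by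
      rintro a b ⟨hne, x, y, hxy, hx, hy⟩
      exact ⟨hne, x, y, hxy, hx, hy⟩
    exact hf.isAcyclic.comap (Hom.ofLE hle) Function.injective_id

include hS in
lemma eq_base_of_isForestContraction {f : V → W} (hf : G.IsForestContraction f) (i j : ι) (x y : V)
    (hij : i ≠ j) (hx : x ∈ S i) (hy : y ∈ S j) (hxy : f x = f y) : f x = f v := by
  by_contra hne
  have h := (hf.reachable x y hxy).closed (P := fun a ↦ a ∈ S i ∧ f a ≠ f v) (by
    rintro a b ⟨hab, hfab⟩ ⟨hai, hav⟩
    obtain ⟨l, hal, hbl⟩ := hS.adj hab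
    by_cases hil : i = l
    · exact ⟨hil ▸ hbl, hfab ▸ hav⟩
    · exact absurd (congrArg f (hS.eq_of_mem hil hai hal)) hav) ⟨hx, hne⟩
  exact h.2 (congrArg f (hS.eq_of_mem hij h.1 hy))

section Glue

variable {X : ι → Type} (g : ∀ i, S i → X i)

/-- The map on `V` obtained by gluing maps on the sets `S i` at `v`. -/
noncomputable def glue (x : V) (i : ι) : X i := g i (hS.retract i x)

lemma glue_of_mem {i : ι} {x : V} (h : x ∈ S i) : hS.glue g x i = g i ⟨x, h⟩ := by
  rw [glue, hS.retract_of_mem h]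

lemma glue_apply_eq {i j : ι} (hij : i ≠ j) {x y : V} (hx : x ∈ S j) (hy : y ∈ S j) :
    hS.glue g x i = hS.glue g y i := by
  rw [glue, glue, hS.retract_of_ne hij hx, hS.retract_of_ne hij hy]

lemma glue_eq_iff {i : ι} {x y : V} (hx : x ∈ S i) (hy : y ∈ S i) :
    hS.glue g x = hS.glue g y ↔ g i ⟨x, hx⟩ = g i ⟨y, hy⟩ := by
  rw [← hS.glue_of_mem g hx, ← hS.glue_of_mem g hy]
  refine ⟨fun h ↦ congrFun h i, fun h ↦ funext fun j ↦ ?_⟩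
  by_cases hij : j = i
  · rw [hij, h]
  · exact hS.glue_apply_eq g hij hx hy

variable (hg : ∀ i, (G.induce (S i)).IsForestContraction (g i))

include hg in
lemma reachable_glue {x y : V} (hxy : hS.glue g x = hS.glue g y) :
    (G.fiberGraph (hS.glue g)).Reachable x y := by
  have hpart : ∀ {i a b}, a ∈ S i → b ∈ S i → hS.glue g a = hS.glue g b →
      (G.fiberGraph (hS.glue g)).Reachable a b := by
    intro i a b ha hb hab
    exact ((hg i).reachable ⟨a, ha⟩ ⟨b, hb⟩ ((hS.glue_eq_iff g ha hb).1 hab)).lift Subtype.val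
      fun c d hcd ↦ by exact Adj.reachable ⟨hcd.1, (hS.glue_eq_iff g c.2 d.2).2 hcd.2⟩
  have hbase : ∀ {a}, hS.glue g a = hS.glue g v →
      (G.fiberGraph (hS.glue g)).Reachable a v := by
    intro a ha
    rcases hS.cover a with rfl | ⟨i, hi⟩
    · rfl
    · exact hpart hi (hS.mem i) ha
  rcases hS.cover x with rfl | ⟨i, hi⟩
  · exact (hbase hxy.symm).symm
  · by_cases hy : y ∈ S i
    · exact hpart hi hy hxy
    · have hxv : hS.glue g x = hS.glue g v := by
        rw [hS.glue_eq_iff g hi (hS.mem i), ← hS.glue_of_mem g hi, hxy, glue,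
          hS.retract_of_notMem hy]
      exact (hbase hxv).trans (hbase (hxy.symm.trans hxv)).symm

include hg in
lemma isAcyclic_map_glue : (G.map (hS.glue g)).IsAcyclic := by
  apply isAcyclic_of_forall_adj_exists_image
  rintro _ _ ⟨hne, x, y, hxy, rfl, rfl⟩
  obtain ⟨i, hx, hy⟩ := hS.adj hxy
  refine ⟨X i, (G.induce (S i)).map (g i), fun w ↦ w i, (hg i).isAcyclic, ?_, ?_⟩
  · simp only [hS.glue_of_mem g hx, hS.glue_of_mem g hy]
    exact map_adj_apply' (G := G.induce (S i)) (u := ⟨x, hx⟩) (v := ⟨y, hy⟩) hxy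
      fun h ↦ hne ((hS.glue_eq_iff g hx hy).2 h)
  · rintro _ _ ⟨hne', a, b, hab, rfl, rfl⟩
    obtain ⟨j, ha, hb⟩ := hS.adj hab
    by_cases hij : i = j
    · subst hij
      right
      simp only [hS.glue_of_mem g hx, hS.glue_of_mem g hy, hS.glue_of_mem g ha,
        hS.glue_of_mem g hb]
      refine ⟨map_adj_apply' (G := G.induce (S i)) (u := ⟨a, ha⟩) (v := ⟨b, hb⟩) hab
        fun h ↦ hne' ((hS.glue_eq_iff g ha hb).2 h), ?_⟩
      simp only [Sym2.eq_iff, hS.glue_eq_iff g ha hx, hS.glue_eq_iff g hb hy,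
        hS.glue_eq_iff g ha hy, hS.glue_eq_iff g hb hx, imp_self]
    · exact Or.inl (hS.glue_apply_eq g hij ha hb)

include hg in
lemma isForestContraction_glue : G.IsForestContraction (hS.glue g) :=
  ⟨fun _ _ ↦ hS.reachable_glue g hg, hS.isAcyclic_map_glue g hg⟩

lemma ncard_range_le_ncard_image_glue [Finite V] (i : ι) :
    (Set.range (g i)).ncard ≤ (hS.glue g '' S i).ncard := by
  have : Set.range (g i) = (fun w : ∀ i, X i ↦ w i) '' (hS.glue g '' S i) := by
    ext w
    simp only [Set.mem_range, Set.image_image, Set.mem_image, Subtype.exists]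
    constructor
    · rintro ⟨x, hx, rfl⟩; exact ⟨x, hx, hS.glue_of_mem g hx⟩
    · rintro ⟨x, hx, rfl⟩; exact ⟨x, hx, (hS.glue_of_mem g hx).symm⟩
  rw [this]
  exact Set.ncard_image_le ((Set.toFinite _).image _)

end Glue

include hS in
theorem kContractibleToTree_iff [Finite V] [Finite ι] (hG : G.Connected) (k : ℕ) :
    KContractibleToTree G k ↔
      ∃ κ : ι → ℕ, ∑ᶠ i, κ i ≤ k ∧ ∀ i, KContractibleToTree (G.induce (S i)) (κ i) := by
  have := Fintype.ofFinite ι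
  constructor
  · intro h
    obtain ⟨n, f, hf, hk⟩ := exists_isForestContraction h
    refine ⟨fun i ↦ (S i).ncard - (f '' S i).ncard, ?_, fun i ↦ ?_⟩
    · rw [hS.card_eq, hS.ncard_range f (hS.eq_base_of_isForestContraction hf)] at hk
      simp only [finsum_eq_sum_of_fintype] at hk ⊢
      have hsum : ∑ i, ((S i).ncard - 1) =
          ∑ i, ((f '' S i).ncard - 1) + ∑ i, ((S i).ncard - (f '' S i).ncard) := by
        rw [← Finset.sum_add_distrib]
        refine Finset.sum_congr rfl fun i _ ↦ ?_
        have h₁ : (f '' S i).ncard ≤ (S i).ncard := Set.ncard_image_le (Set.toFinite _)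
        have h₂ : 0 < (f '' S i).ncard :=
          (Set.ncard_pos (Set.toFinite _)).2 ⟨f v, v, hS.mem i, rfl⟩
        omega
      omega
    · refine (hS.isForestContraction_restrict hf i).kContractibleToTree
        (hS.connected_induce hG i) ?_
      rw [Nat.card_coe_set_eq, ← Function.comp_def, Set.range_comp, Subtype.range_coe]
      exact le_add_tsub
  · rintro ⟨κ, hκ, h⟩
    choose n g hg hcard using fun i ↦ exists_isForestContraction (h i)
    have hf := hS.isForestContraction_glue g hg
    refine hf.kContractibleToTree hG ?_
    rw [hS.card_eq, hS.ncard_range _ (hS.eq_base_of_isForestContraction hf)]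
    simp only [finsum_eq_sum_of_fintype] at hκ ⊢
    have hsum : ∑ i, ((S i).ncard - 1) ≤
        ∑ i, ((hS.glue g '' S i).ncard - 1) + ∑ i, κ i := by
      rw [← Finset.sum_add_distrib]
      refine Finset.sum_le_sum fun i _ ↦ ?_
      have h₁ := hcard i
      rw [Nat.card_coe_set_eq] at h₁
      have h₂ := hS.ncard_range_le_ncard_image_glue g i
      have h₃ : 0 < (hS.glue g '' S i).ncard :=
        (Set.ncard_pos ((Set.toFinite _).image _)).2 ⟨_, v, hS.mem i, rfl⟩
      omega
    omega

end IsVertexSum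

lemma isVertexSum_components (G : SimpleGraph V) (v : V) :
    G.IsVertexSum v fun C : (G.induce ({v}ᶜ : Set V)).ConnectedComponent ↦
      insert v (Subtype.val '' C.supp) where
  mem _ := Set.mem_insert _ _
  cover x := by
    by_cases hx : x = v
    · exact Or.inl hx
    · exact Or.inr ⟨(G.induce ({v}ᶜ : Set V)).connectedComponentMk ⟨x, hx⟩,
        Or.inr ⟨⟨x, hx⟩, rfl, rfl⟩⟩
  eq_of_mem := by
    rintro C D x hCD (rfl | ⟨y, rfl, rfl⟩) h
    · rfl
    · rcases h with h | ⟨z, rfl, hz⟩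
      · exact h
      · exact absurd (by rw [Subtype.ext hz]) hCD
  adj := by
    intro x y hxy
    by_cases hx : x = v
    · by_cases hy : y = v
      · exact absurd (hx.trans hy.symm) hxy.ne
      · exact ⟨(G.induce ({v}ᶜ : Set V)).connectedComponentMk ⟨y, hy⟩,
          Or.inl hx, Or.inr ⟨⟨y, hy⟩, rfl, rfl⟩⟩
    · refine ⟨(G.induce ({v}ᶜ : Set V)).connectedComponentMk ⟨x, hx⟩,
        Or.inr ⟨⟨x, hx⟩, rfl, rfl⟩, ?_⟩
      by_cases hy : y = v
      · exact Or.inl hy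
      · refine Or.inr ⟨⟨y, hy⟩, ConnectedComponent.sound ?_, rfl⟩
        exact Adj.reachable (G := G.induce ({v}ᶜ : Set V)) hxy.symm

end SimpleGraph

theorem stmt7 {V : Type} [Finite V] (G : SimpleGraph V) (hG : G.Connected) (v : V)
    (hv : ¬ (G.induce ({v}ᶜ : Set V)).Connected) (k : ℕ) :
    KContractibleToTree G k ↔
      ∃ κ : (G.induce ({v}ᶜ : Set V)).ConnectedComponent → ℕ,
        (∑ᶠ C, κ C) ≤ k ∧
        ∀ C : (G.induce ({v}ᶜ : Set V)).ConnectedComponent,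
          KContractibleToTree (G.induce (insert v (Subtype.val '' C.supp))) (κ C) :=
  (isVertexSum_components G v).kContractibleToTree_iff hG k
end

section
/- Let G be a 2-connected graph and let W be a T-witness structure of G for a tree T. Then for every vertex v of T having degree at least 2 in T, the witness set W(v) is big; equivalently, every small witness set of W is of the form W(v') for a leaf v' of T. -/
open SimpleGraph

/-- A graph is 2-connected if it is connected, has at least three vertices, and has no
cut vertex. -/
def TwoConnected {V : Type} (G : SimpleGraph V) : Prop :=
  G.Connected ∧ 3 ≤ Nat.card V ∧ ∀ v : V, (G.induce ({v}ᶜ : Set V)).Connected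

/-- If `f` sends adjacent vertices of `G` to vertices of `H` reachable from each other, it
preserves reachability. -/
theorem SimpleGraph.Reachable.of_forall_adj {V W : Type} {G : SimpleGraph V} {H : SimpleGraph W}
    {f : V → W} (hf : ∀ u v, G.Adj u v → H.Reachable (f u) (f v)) {u v : V}
    (h : G.Reachable u v) : H.Reachable (f u) (f v) := by
  obtain ⟨p⟩ := h
  induction p with
  | nil => exact .rfl
  | cons hadj _ ih => exact (hf _ _ hadj).trans ih

theorem exists_fiber_eq_singleton_of_not_bigSet {V W : Type} [Finite V] {f : V → W}
    (hf : Function.Surjective f) {w : W} (hw : ¬ BigSet f w) : ∃ x, f ⁻¹' {w} = {x} := by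
  obtain ⟨x, hx⟩ := hf w
  have hpos : 0 < (f ⁻¹' {w}).ncard := (Set.ncard_pos).2 ⟨x, hx⟩
  unfold BigSet at hw
  exact Set.ncard_eq_one.1 (by omega)

/-- Contracting the witness sets of `G - x`, where `{x}` is the witness set of `w`, does not
use the edges of `T` at `w`. -/
theorem bigSet_of_adj_of_adj {V W : Type} [Finite V] {G : SimpleGraph V} {T : SimpleGraph W}
    (hG : TwoConnected G) (hT : T.IsAcyclic) {f : V → W} (hf : IsWitnessStructure G T f)
    {w a b : W} (ha : T.Adj w a) (hb : T.Adj w b) (hab : a ≠ b) : BigSet f w := by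
  by_contra hw
  obtain ⟨x, hx⟩ := exists_fiber_eq_singleton_of_not_bigSet hf.1 hw
  have hfx (y : V) : f y = w ↔ y = x := by
    simpa using Set.ext_iff.1 hx y
  obtain ⟨u, rfl⟩ := hf.1 a
  obtain ⟨v, rfl⟩ := hf.1 b
  have hu : u ≠ x := fun h => ha.ne ((hfx u).2 h).symm
  have hv : v ≠ x := fun h => hb.ne ((hfx v).2 h).symm
  have hbridge := isAcyclic_iff_forall_adj_isBridge.1 hT ha
  rw [isBridge_iff] at hbridge
  have hreach : (T.deleteEdges {s(w, f u)}).Reachable (f v) (f u) := by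
    refine Reachable.of_forall_adj (f := fun y : ({x}ᶜ : Set V) => f y) ?_
      ((hG.2.2 x).preconnected ⟨v, hv⟩ ⟨u, hu⟩)
    rintro ⟨y, hy⟩ ⟨z, hz⟩ hyz
    have hyw : f y ≠ w := fun h => hy ((hfx y).1 h)
    have hzw : f z ≠ w := fun h => hz ((hfx z).1 h)
    by_cases hfyz : f y = f z
    · simp [hfyz]
    · have hadj : T.Adj (f y) (f z) := (hf.2.2 _ _ hfyz).2 ⟨y, z, rfl, rfl, hyz⟩
      refine Adj.reachable ?_
      simp [deleteEdges_adj, hadj, hyw, hzw]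
  refine hbridge (Reachable.trans (Adj.reachable ?_) hreach)
  simp [deleteEdges_adj, hb, hab.symm, ha.ne]

theorem stmt9 {V W : Type} [Finite V] [Finite W] (G : SimpleGraph V) (T : SimpleGraph W)
    (hG : TwoConnected G) (hT : T.IsTree) (f : V → W) (hf : IsWitnessStructure G T f) :
    (∀ w : W, 2 ≤ (T.neighborSet w).ncard → BigSet f w) ∧
    (∀ w : W, ¬ BigSet f w → (T.neighborSet w).ncard = 1) := by
  have hbig : ∀ w : W, 2 ≤ (T.neighborSet w).ncard → BigSet f w := by
    intro w hw
    obtain ⟨a, ha, b, hb, hab⟩ := (Set.one_lt_ncard).1 hw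
    exact bigSet_of_adj_of_adj hG hT.isAcyclic hf ha hb hab
  refine ⟨hbig, fun w hw => ?_⟩
  have hle : ¬ 2 ≤ (T.neighborSet w).ncard := fun h => hw (hbig w h)
  have hne : 0 < (T.neighborSet w).ncard := by
    obtain ⟨x, hx⟩ := exists_fiber_eq_singleton_of_not_bigSet hf.1 hw
    have hV : 1 < Nat.card V := by have := hG.2.1; omega
    have : Nontrivial V := Finite.one_lt_card_iff_nontrivial.1 hV
    obtain ⟨y, hy⟩ := exists_ne x
    have hyw : f y ≠ w := fun h => hy (by simpa using (Set.ext_iff.1 hx y).1 h)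
    have : Nontrivial W := ⟨f y, w, hyw⟩
    obtain ⟨a, ha⟩ := hT.connected.preconnected.exists_adj_of_nontrivial w
    exact (Set.ncard_pos).2 ⟨a, ha⟩
  omega
end

section
/- Let G be a 2-connected graph, let T be a tree, and let φ be a 2-coloring of G that is compatible with a T-witness structure W of G. Let X be a monochromatic component of G with respect to φ that is the union of witness sets W(v_1), …, W(v_p) with p ≥ 2, where W(v_1) is big. Then W(v_2), …, W(v_p) are all small, the vertices v_2, …, v_p are leaves of T adjacent to v_1 (so v_1, …, v_p induce a star in T with center v_1), and W(v_1) is a connected vertex cover of the subgraph of G induced by X that contains every vertex of X having a neighbor in V(G) \ X. -/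
open SimpleGraph

/-- A 2-coloring `φ` is compatible with the `T`-witness structure given by `f`:
every witness set is monochromatic, and big witness sets corresponding to adjacent
vertices of `T` receive different colors. -/
def TreeCompatible {V W : Type} (G : SimpleGraph V) (T : SimpleGraph W) (f : V → W)
    (φ : V → Fin 2) : Prop :=
  (∀ x y : V, f x = f y → φ x = φ y) ∧
  ∀ u v : W, T.Adj u v → BigSet f u → BigSet f v →
    ∀ x y : V, f x = u → f y = v → φ x ≠ φ y

theorem BigSet.eq_of_not {V W : Type} [Finite V] {f : V → W} {w : W} (h : ¬ BigSet f w)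
    {u v : V} (hu : f u = w) (hv : f v = w) : u = v := by
  unfold BigSet at h
  exact (Set.ncard_le_one (Set.toFinite _)).1 (not_lt.1 h) u hu v hv

/-- Two vertices of the decomposed graph joined by a walk outside a witness set are mapped to
vertices of the quotient joined by a walk avoiding the corresponding vertex. -/
theorem IsWitnessStructure.exists_walk_avoiding {V W : Type} {G : SimpleGraph V}
    {T : SimpleGraph W} {f : V → W} (hf : IsWitnessStructure G T f) {w : W} {s : Set V}
    (hs : ∀ v ∈ s, f v ≠ w) {y z : s} (p : (G.induce s).Walk y z) :
    ∃ r : T.Walk (f y) (f z), w ∉ r.support := by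
  induction p with
  | @nil u => exact ⟨Walk.nil, by simpa using (hs u u.2).symm⟩
  | @cons u v z h p ih =>
    obtain ⟨r, hr⟩ := ih
    by_cases huv : f u = f v
    · exact ⟨r.copy huv.symm rfl, by simpa using hr⟩
    · have hT : T.Adj (f u) (f v) := (hf.2.2 _ _ huv).2 ⟨u, v, rfl, rfl, h⟩
      refine ⟨Walk.cons hT r, ?_⟩
      simp only [Walk.support_cons, List.mem_cons, not_or]
      exact ⟨(hs u u.2).symm, hr⟩

/-- In an acyclic graph, every walk between two distinct neighbors of `w` visits `w`. -/
theorem SimpleGraph.IsAcyclic.mem_support_of_adj {W : Type} {T : SimpleGraph W}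
    (hT : T.IsAcyclic) {a b w : W} (ha : T.Adj a w) (hb : T.Adj w b) (hab : a ≠ b)
    (r : T.Walk a b) : w ∈ r.support := by
  classical
  have hp : (Walk.cons ha (Walk.cons hb Walk.nil)).IsPath := by
    simp [Walk.cons_isPath_iff, ha.ne, hb.ne, hab]
  have h := (hT.subsingleton_path a b).elim r.toPath ⟨_, hp⟩
  apply r.support_toPath_subset_support
  rw [h]
  simp

/-- In a tree-witness structure of a 2-connected graph, a vertex with a small witness set has
at most one neighbor in the tree. -/
theorem IsWitnessStructure.eq_of_adj_of_not_bigSet {V W : Type} [Finite V] {G : SimpleGraph V}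
    {T : SimpleGraph W} {f : V → W} (hf : IsWitnessStructure G T f) (hG : TwoConnected G)
    (hT : T.IsTree) {a b w : W} (hw : ¬ BigSet f w) (ha : T.Adj w a) (hb : T.Adj w b) :
    a = b := by
  by_contra hab
  obtain ⟨x, hx⟩ := hf.1 w
  obtain ⟨y, rfl⟩ := hf.1 a
  obtain ⟨z, rfl⟩ := hf.1 b
  have hyx : y ∈ ({x}ᶜ : Set V) := by
    rintro rfl
    exact ha.ne hx.symm
  have hzx : z ∈ ({x}ᶜ : Set V) := by
    rintro rfl
    exact hb.ne hx.symm
  obtain ⟨p⟩ := (hG.2.2 x).preconnected ⟨y, hyx⟩ ⟨z, hzx⟩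
  obtain ⟨r, hr⟩ := hf.exists_walk_avoiding (w := w)
    (s := {x}ᶜ) (fun v hv h => hv (BigSet.eq_of_not hw h hx)) p
  exact hr (hT.isAcyclic.mem_support_of_adj ha.symm hb hab r)

/-- A monochromatic component `X` that is the union of the witness sets of the pairwise
distinct vertices `v₁, vs 0, …, vs (q-1)` (so of `p = q + 1 ≥ 2` witness sets), where the
witness set of `v₁` is big: then the other witness sets are small, their vertices are
leaves of `T` adjacent to `v₁` (so these vertices induce a star in `T` with center `v₁`),
and the witness set of `v₁` is a connected vertex cover of the subgraph of `G` induced by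
`X` containing every vertex of `X` that has a neighbor outside `X`. -/
theorem stmt11 {V W : Type} [Finite V] [Finite W] (G : SimpleGraph V) (T : SimpleGraph W)
    (hG : TwoConnected G) (hT : T.IsTree) (f : V → W) (hf : IsWitnessStructure G T f)
    (φ : V → Fin 2) (hφ : TreeCompatible G T f φ)
    (v₁ : W) (q : ℕ) (hq : 1 ≤ q) (vs : Fin q → W)
    (hinj : Function.Injective vs) (hne : ∀ i : Fin q, vs i ≠ v₁)
    (X : Set V) (hX : MonoComponent G φ X)
    (hXunion : X = f ⁻¹' {v₁} ∪ ⋃ i : Fin q, f ⁻¹' {vs i})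
    (hbig : BigSet f v₁) :
    (∀ i : Fin q, ¬ BigSet f (vs i)) ∧
    (∀ i : Fin q, T.Adj v₁ (vs i) ∧ (T.neighborSet (vs i)).ncard = 1) ∧
    (G.induce (f ⁻¹' {v₁})).Connected ∧
    (∀ x y : V, x ∈ X → y ∈ X → G.Adj x y → f x = v₁ ∨ f y = v₁) ∧
    (∀ x : V, x ∈ X → (∃ z : V, z ∉ X ∧ G.Adj x z) → f x = v₁) := by
  have hmem : ∀ x, x ∈ X ↔ f x = v₁ ∨ ∃ i, f x = vs i := by
    intro x
    simp [hXunion]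
  have hmono := hX.2.1
  have hsmall : ∀ w, (∃ i, w = vs i) → T.Adj v₁ w → ¬ BigSet f w := by
    rintro _ ⟨i, rfl⟩ hadj hb
    obtain ⟨x, hx⟩ := hf.1 v₁
    obtain ⟨y, hy⟩ := hf.1 (vs i)
    exact hφ.2 _ _ hadj hbig hb x y hx hy
      (hmono x ((hmem x).2 (Or.inl hx)) y ((hmem y).2 (Or.inr ⟨i, hy⟩)))
  have hadj_of_edge : ∀ x y, f x ≠ f y → G.Adj x y → T.Adj (f x) (f y) :=
    fun x y hne h => (hf.2.2 _ _ hne).2 ⟨x, y, rfl, rfl, h⟩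
  have hreach : ∀ (x y : X), (G.induce X).Walk x y → (f x = v₁ ∨ T.Adj v₁ (f x)) →
      (f y = v₁ ∨ T.Adj v₁ (f y)) := by
    intro x y p
    induction p with
    | nil => exact id
    | @cons x z y h p ih =>
      intro hx
      apply ih
      by_cases hxz : f x = f z
      · rwa [← hxz]
      have hT' := hadj_of_edge x z hxz h
      rcases hx with hx | hx
      · exact Or.inr (hx ▸ hT')
      · have hi := ((hmem x).1 x.2).resolve_left hx.ne'
        exact Or.inl (hf.eq_of_adj_of_not_bigSet hG hT (hsmall _ hi hx) hT' hx.symm)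
  have hadj : ∀ i, T.Adj v₁ (vs i) := by
    intro i
    obtain ⟨x, hx⟩ := hf.1 v₁
    obtain ⟨y, hy⟩ := hf.1 (vs i)
    obtain ⟨p⟩ := hX.2.2.1.preconnected ⟨x, (hmem x).2 (Or.inl hx)⟩
      ⟨y, (hmem y).2 (Or.inr ⟨i, hy⟩)⟩
    have h := hreach _ _ p (Or.inl hx)
    simp only [hy] at h
    exact h.resolve_left (hne i)
  have hleaf : ∀ i w, T.Adj (vs i) w → w = v₁ := fun i w h =>
    hf.eq_of_adj_of_not_bigSet hG hT (hsmall _ ⟨i, rfl⟩ (hadj i)) h (hadj i).symm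
  refine ⟨fun i => hsmall _ ⟨i, rfl⟩ (hadj i), fun i => ⟨hadj i, ?_⟩, hf.2.1 v₁, ?_, ?_⟩
  · rw [Set.ncard_eq_one]
    refine ⟨v₁, Set.eq_singleton_iff_unique_mem.2 ⟨(hadj i).symm, fun w hw => hleaf i w hw⟩⟩
  · intro x y hx _ hxy
    refine ((hmem x).1 hx).imp_right ?_
    rintro ⟨i, hi⟩
    have hxy' : f x ≠ f y := fun h =>
      hxy.ne (BigSet.eq_of_not (hsmall _ ⟨i, rfl⟩ (hadj i)) hi (h ▸ hi))
    exact hleaf i _ (hi ▸ hadj_of_edge x y hxy' hxy)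
  · rintro x hx ⟨z, hz, hxz⟩
    refine ((hmem x).1 hx).resolve_right ?_
    rintro ⟨i, hi⟩
    have hxz' : f x ≠ f z := fun h => hz ((hmem z).2 (Or.inr ⟨i, h ▸ hi⟩))
    exact hz ((hmem z).2 (Or.inl (hleaf i _ (hi ▸ hadj_of_edge x z hxz' hxz))))
end

section
/- Let G be a bipartite graph with parts A and B such that every vertex of A has a neighbor in B, let t be a positive integer with t ≤ |A|, set k = |A| + t, and let G' be the graph obtained from G by adding a new vertex a adjacent to every vertex of B and, for every u ∈ A, adding k+1 new vertices each adjacent to exactly u and a. If there exists a set S ⊆ B with |S| ≤ t that dominates A, then G' is k-contractible to a tree. -/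
open SimpleGraph

/-- The vertex type of the graph `G'` built from the bipartite graph with parts `α`, `β`:
the original vertices (`Sum.inl u` for `u ∈ A`, `Sum.inr (Sum.inl b)` for `b ∈ B`),
the new vertex `a` (`Sum.inr (Sum.inr (Sum.inl ()))`), and `k+1` new vertices for
every `u ∈ A` (`Sum.inr (Sum.inr (Sum.inr (u, i)))`). -/
abbrev GadgetVertex (α β : Type) (k : ℕ) : Type := α ⊕ β ⊕ Unit ⊕ (α × Fin (k + 1))

/-- The graph `G'` obtained from the bipartite graph `(α, β, E)` by adding a new vertex `a`
adjacent to every vertex of `β` and, for every `u : α`, `k+1` new vertices each adjacent to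
exactly `u` and `a`. -/
def gadget {α β : Type} (E : α → β → Prop) (k : ℕ) : SimpleGraph (GadgetVertex α β k) :=
  SimpleGraph.fromRel (fun x y =>
    match x, y with
    | Sum.inl u, Sum.inr (Sum.inl b) => E u b
    | Sum.inr (Sum.inr (Sum.inl _)), Sum.inr (Sum.inl _) => True
    | Sum.inr (Sum.inr (Sum.inr (u, _))), Sum.inl u' => u' = u
    | Sum.inr (Sum.inr (Sum.inr _)), Sum.inr (Sum.inr (Sum.inl _)) => True
    | _, _ => False)

open scoped Classical in
/-- Contracting a connected dominating set with independent complement yields a star. -/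
theorem kContractibleToTree_of_connected_dominating {V : Type} [Finite V] (G : SimpleGraph V)
    (D : Set V) (k : ℕ) (hconn : (G.induce D).Connected)
    (hdom : ∀ x ∉ D, ∃ y ∈ D, G.Adj y x) (hind : ∀ x ∉ D, ∀ y ∉ D, ¬ G.Adj x y)
    (hcard : D.ncard ≤ k + 1) : KContractibleToTree G k := by
  obtain ⟨d, hd⟩ : D.Nonempty := Set.nonempty_coe_sort.mp hconn.nonempty
  let e : Option ↥Dᶜ ≃ Fin (Nat.card (Option ↥Dᶜ)) := Finite.equivFin _
  let g : V → Option ↥Dᶜ := fun x => if h : x ∈ D then none else some ⟨x, h⟩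
  have g_eq_none : ∀ x, g x = none ↔ x ∈ D := fun x => by simp [g]
  have g_eq_some : ∀ x (y : ↥Dᶜ), g x = some y ↔ x = y := by
    rintro x ⟨y, hy⟩
    by_cases h : x ∈ D
    · simp only [g, h, dif_pos, reduceCtorEq, false_iff]
      rintro rfl
      exact hy h
    · simp [g, h]
  have fiber_none : (fun x => e (g x)) ⁻¹' {e none} = D := by
    ext x
    simp [g_eq_none]
  have fiber_some : ∀ y : ↥Dᶜ, (fun x => e (g x)) ⁻¹' {e (some y)} = {(y : V)} := by
    intro y
    ext x
    simp [g_eq_some]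
  refine ⟨_, starGraph (e none), isTree_starGraph _, ⟨fun x => e (g x), ?_, ?_, ?_⟩, ?_⟩
  · intro w
    obtain ⟨w, rfl⟩ := e.surjective w
    cases w with
    | none => exact ⟨d, congrArg e ((g_eq_none d).2 hd)⟩
    | some y => exact ⟨y, congrArg e ((g_eq_some y y).2 rfl)⟩
  · intro w
    obtain ⟨w, rfl⟩ := e.surjective w
    cases w with
    | none => rwa [fiber_none]
    | some y =>
      rw [fiber_some]
      exact Connected.of_subsingleton
  · intro w₁ w₂ hne
    obtain ⟨w₁, rfl⟩ := e.surjective w₁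
    obtain ⟨w₂, rfl⟩ := e.surjective w₂
    simp only [starGraph_adj, e.apply_eq_iff_eq]
    rcases w₁ with _ | x <;> rcases w₂ with _ | y
    · exact absurd rfl hne
    · obtain ⟨z, hz, hzy⟩ := hdom y y.2
      simpa [g_eq_none, g_eq_some] using ⟨z, hz, hzy⟩
    · obtain ⟨z, hz, hzx⟩ := hdom x x.2
      simpa [g_eq_none, g_eq_some] using ⟨z, hz, hzx.symm⟩
    · simpa [g_eq_some] using hind x x.2 y y.2
  · rw [Nat.card_fin, Finite.card_option, Nat.card_coe_set_eq]
    have := Set.ncard_add_ncard_compl D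
    omega

theorem stmt14 {α β : Type} [Finite α] [Finite β] (E : α → β → Prop)
    (hE : ∀ u : α, ∃ b : β, E u b) (t : ℕ) (ht : 1 ≤ t) (htA : t ≤ Nat.card α)
    (k : ℕ) (hk : k = Nat.card α + t)
    (S : Set β) (hS : S.ncard ≤ t) (hdom : ∀ u : α, ∃ b ∈ S, E u b) :
    KContractibleToTree (gadget E k) k := by
  let D : Set (GadgetVertex α β k) :=
    (Set.range Sum.inl ∪ (fun b => Sum.inr (Sum.inl b)) '' S) ∪ {Sum.inr (Sum.inr (Sum.inl ()))}
  apply kContractibleToTree_of_connected_dominating (gadget E k) D k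
  · have center : Sum.inr (Sum.inr (Sum.inl ())) ∈ D := by simp [D]
    have reach_right : ∀ b (hb : Sum.inr (Sum.inl b) ∈ D),
        ((gadget E k).induce D).Reachable ⟨_, center⟩ ⟨Sum.inr (Sum.inl b), hb⟩ :=
      fun b hb => Adj.reachable (by simp [gadget])
    rw [connected_iff_exists_forall_reachable]
    refine ⟨⟨_, center⟩, ?_⟩
    rintro ⟨u | b | a | p, hx⟩
    · obtain ⟨b, hb, hub⟩ := hdom u
      have hbD : Sum.inr (Sum.inl b) ∈ D := by simp [D, hb]
      exact (reach_right b hbD).trans (Adj.reachable (by simp [gadget, hub]))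
    · exact reach_right b hx
    · rfl
    · simp [D] at hx
  · intro x hx
    refine ⟨Sum.inr (Sum.inr (Sum.inl ())), by simp [D], ?_⟩
    rcases x with u | b | a | p
    · simp [D] at hx
    · simp [gadget]
    · simp [D] at hx
    · simp [gadget]
  · rintro (u | b | a | p) hx (v | c | a' | q) hy <;> simp_all [D, gadget]
  · have h₁ := Set.ncard_union_le (Set.range Sum.inl ∪ (fun b => Sum.inr (Sum.inl b)) '' S)
      {(Sum.inr (Sum.inr (Sum.inl ())) : GadgetVertex α β k)}
    have h₂ := Set.ncard_union_le (Set.range (Sum.inl : α → GadgetVertex α β k))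
      ((fun b => Sum.inr (Sum.inl b)) '' S)
    have h₃ : (Set.range (Sum.inl : α → GadgetVertex α β k)).ncard = Nat.card α := by
      rw [← Nat.card_coe_set_eq, Nat.card_range_of_injective Sum.inl_injective]
    have h₄ := Set.ncard_image_le (s := S)
      (f := fun b => (Sum.inr (Sum.inl b) : GadgetVertex α β k))
    rw [Set.ncard_singleton] at h₁
    show Set.ncard (_ ∪ _) ≤ _
    omega
end

section
/- Let G be a bipartite graph with parts A and B such that every vertex of A has a neighbor in B, let t be a positive integer with t ≤ |A|, set k = |A| + t, and let G' be the graph obtained from G by adding a new vertex a adjacent to every vertex of B and, for every u ∈ A, adding k+1 new vertices each adjacent to exactly u and a. If G' is k-contractible to a tree, then there exists a set S ⊆ B with |S| ≤ t that dominates A. -/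
open SimpleGraph

theorem SimpleGraph.Connected.exists_adj_of_induce {V : Type} {G : SimpleGraph V} {s : Set V}
    (hs : (G.induce s).Connected) {x y : V} (hx : x ∈ s) (hy : y ∈ s) (hxy : x ≠ y) :
    ∃ z ∈ s, G.Adj x z := by
  obtain ⟨p⟩ := hs.preconnected ⟨x, hx⟩ ⟨y, hy⟩
  cases p with
  | nil => exact absurd rfl hxy
  | cons h _ => exact ⟨_, Subtype.property _, h⟩

theorem SimpleGraph.IsAcyclic.eq_of_adj_adj {W : Type} {T : SimpleGraph W} (hT : T.IsAcyclic)
    {p m m' q : W} (hpq : p ≠ q) (h₁ : T.Adj p m) (h₂ : T.Adj m q)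
    (h₁' : T.Adj p m') (h₂' : T.Adj m' q) : m = m' := by
  have := (hT.subsingleton_path p q).elim
    ⟨Walk.cons h₁ (Walk.cons h₂ Walk.nil), by simp [h₁.ne, h₂.ne, hpq]⟩
    ⟨Walk.cons h₁' (Walk.cons h₂' Walk.nil), by simp [h₁'.ne, h₂'.ne, hpq]⟩
  have h := congrArg (fun w : T.Path p q => w.1.support) this
  simpa using h

theorem SimpleGraph.IsAcyclic.not_adj_of_adj_adj {W : Type} {T : SimpleGraph W}
    (hT : T.IsAcyclic) {p m q : W} (h₁ : T.Adj p m) (h₂ : T.Adj m q) : ¬ T.Adj p q := by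
  intro h₃
  have := (hT.subsingleton_path p q).elim
    ⟨Walk.cons h₁ (Walk.cons h₂ Walk.nil), by simp [h₁.ne, h₂.ne, h₃.ne]⟩
    ⟨Walk.cons h₃ Walk.nil, by simp [h₃.ne]⟩
  have h := congrArg (fun w : T.Path p q => w.1.length) this
  simp at h

theorem Function.Surjective.ncard_le_card_sub_card {V W : Type} [Finite V] {f : V → W}
    (hf : Function.Surjective f) (P : Set V) (hP : ∀ x ∈ P, ∃ y ∉ P, f y = f x) :
    P.ncard ≤ Nat.card V - Nat.card W := by
  have : f '' Pᶜ = Set.univ := by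
    refine Set.eq_univ_of_forall fun w => ?_
    obtain ⟨v, rfl⟩ := hf w
    by_cases hv : v ∈ P
    · exact hP v hv
    · exact ⟨v, hv, rfl⟩
  have h₁ : Nat.card W ≤ Pᶜ.ncard := by
    rw [← Set.ncard_univ, ← this]
    exact Set.ncard_image_le (Set.toFinite _)
  have h₂ := Set.ncard_add_ncard_compl P
  omega

theorem IsWitnessStructure.eq_or_adj {V W : Type} {G : SimpleGraph V} {H : SimpleGraph W}
    {f : V → W} (hf : IsWitnessStructure G H f) {x y : V} (h : G.Adj x y) :
    f x = f y ∨ H.Adj (f x) (f y) :=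
  or_iff_not_imp_left.2 fun hne => (hf.2.2 _ _ hne).2 ⟨x, y, rfl, rfl, h⟩

namespace GadgetVertex

variable {α β : Type} {k : ℕ}

/-- The vertex `a` of the gadget graph. -/
abbrev apex : GadgetVertex α β k := Sum.inr (Sum.inr (Sum.inl ()))

/-- The `i`-th new vertex attached to `u` and `a`. -/
abbrev link (u : α) (i : Fin (k + 1)) : GadgetVertex α β k := Sum.inr (Sum.inr (Sum.inr (u, i)))

end GadgetVertex

open GadgetVertex

theorem gadget_adj_link_iff {α β : Type} (E : α → β → Prop) (k : ℕ) (u : α) (i : Fin (k + 1))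
    (x : GadgetVertex α β k) :
    (gadget E k).Adj (link u i) x ↔ x = Sum.inl u ∨ x = apex := by
  rcases x with v | b | ⟨⟩ | ⟨v, j⟩ <;> simp [gadget, SimpleGraph.fromRel_adj]

theorem gadget_adj_inl {α β : Type} {E : α → β → Prop} {k : ℕ} {u : α}
    {x : GadgetVertex α β k} (h : (gadget E k).Adj (Sum.inl u) x) :
    (∃ b, x = Sum.inr (Sum.inl b) ∧ E u b) ∨ ∃ i, x = link u i := by
  rcases x with v | b | ⟨⟩ | ⟨v, j⟩ <;> simp_all [gadget, SimpleGraph.fromRel_adj]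

/-- Every vertex of `A` lies in the witness set containing `a`. -/
theorem IsWitnessStructure.apply_inl_eq_apply_apex {α β W : Type} [Finite α] [Finite β]
    {E : α → β → Prop} {k : ℕ} {T : SimpleGraph W} {f : GadgetVertex α β k → W}
    (hT : T.IsAcyclic) (hf : IsWitnessStructure (gadget E k) T f) (hk : 0 < k)
    (hc : Nat.card (GadgetVertex α β k) - Nat.card W ≤ k) (u : α) :
    f (Sum.inl u) = f apex := by
  by_contra hne
  have hu (i) : f (link u i) = f (Sum.inl u) ∨ T.Adj (f (link u i)) (f (Sum.inl u)) :=
    hf.eq_or_adj ((gadget_adj_link_iff E k u i _).2 (Or.inl rfl))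
  have ha (i) : f (link u i) = f apex ∨ T.Adj (f (link u i)) (f apex) :=
    hf.eq_or_adj ((gadget_adj_link_iff E k u i _).2 (Or.inr rfl))
  by_cases hall : ∀ i, f (link u i) = f (Sum.inl u) ∨ f (link u i) = f apex
  · have hcard := hf.1.ncard_le_card_sub_card (Set.range (link u)) (by
      rintro _ ⟨i, rfl⟩
      rcases hall i with h | h
      · exact ⟨Sum.inl u, by simp, h.symm⟩
      · exact ⟨apex, by simp, h.symm⟩)
    have hinj : Function.Injective (link u : Fin (k + 1) → GadgetVertex α β k) :=
      fun i j h => by simpa using h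
    rw [← Set.image_univ, Set.ncard_image_of_injective _ hinj, Set.ncard_univ, Nat.card_fin]
      at hcard
    omega
  · push Not at hall
    obtain ⟨i, hiu, hia⟩ := hall
    have hu_i := ((hu i).resolve_left hiu).symm
    have ha_i := (ha i).resolve_left hia
    have hnadj := hT.not_adj_of_adj_adj hu_i ha_i
    have : Nontrivial (Fin (k + 1)) := Fin.nontrivial_iff_two_le.2 (by omega)
    obtain ⟨j, hj⟩ := exists_ne i
    rcases hu j with h | hu_j
    · rcases ha j with h' | h'
      · exact hne (h.symm.trans h')
      · exact hnadj (h ▸ h')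
    rcases ha j with h' | ha_j
    · exact hnadj (h' ▸ hu_j).symm
    have heq := hT.eq_of_adj_adj hne hu_i ha_i hu_j.symm ha_j
    obtain ⟨z, hz, hadj⟩ := (hf.2.1 (f (link u i))).exists_adj_of_induce
      (x := link u i) (y := link u j) rfl heq.symm (by simpa using hj.symm)
    rcases (gadget_adj_link_iff E k u i z).1 hadj with rfl | rfl
    · exact hiu hz.symm
    · exact hia hz.symm

theorem stmt15 {α β : Type} [Finite α] [Finite β] (E : α → β → Prop)
    (hE : ∀ u : α, ∃ b : β, E u b) (t : ℕ) (ht : 1 ≤ t) (htA : t ≤ Nat.card α)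
    (k : ℕ) (hk : k = Nat.card α + t)
    (h : KContractibleToTree (gadget E k) k) :
    ∃ S : Set β, S.ncard ≤ t ∧ ∀ u : α, ∃ b ∈ S, E u b := by
  obtain ⟨n, T, hT, ⟨f, hf⟩, hc⟩ := h
  have hA := hf.apply_inl_eq_apply_apex hT.isAcyclic (by omega) hc
  let S : Set β := {b | f (Sum.inr (Sum.inl b)) = f apex}
  let U : Set α := {u | ∀ b ∈ S, ¬ E u b}
  have hU (u : α) (hu : u ∈ U) : ∃ i, f (link u i) = f apex := by
    obtain ⟨z, hz, hadj⟩ := (hf.2.1 (f apex)).exists_adj_of_induce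
      (x := Sum.inl u) (y := apex) (hA u) rfl (by simp)
    rcases gadget_adj_inl hadj with ⟨b, rfl, hb⟩ | ⟨i, rfl⟩
    · exact absurd hb (hu b hz)
    · exact ⟨i, hz⟩
  have hU' (u : α) : ∃ i, u ∈ U → f (link u i) = f apex := by
    by_cases hu : u ∈ U
    · exact (hU u hu).imp fun _ h _ => h
    · exact ⟨0, fun h => absurd h hu⟩
  choose c hcE using hE
  choose d hd using hU'
  let P₁ : Set (GadgetVertex α β k) := Sum.inl '' Set.univ
  let P₂ : Set (GadgetVertex α β k) := (fun b => Sum.inr (Sum.inl b)) '' S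
  let P₃ : Set (GadgetVertex α β k) := (fun u => link u (d u)) '' U
  have h₁ : P₁.ncard = Nat.card α := by
    rw [Set.ncard_image_of_injective _ Sum.inl_injective, Set.ncard_univ]
  have h₂ : P₂.ncard = S.ncard :=
    Set.ncard_image_of_injective _ (Sum.inr_injective.comp Sum.inl_injective)
  have h₃ : P₃.ncard = U.ncard :=
    Set.ncard_image_of_injective _ fun u v h => by simp at h; exact h.1
  have h₁₂ : Disjoint P₁ P₂ := by
    rw [Set.disjoint_left]; rintro _ ⟨u, -, rfl⟩ ⟨b, -, h⟩; simp at h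
  have h₁₂₃ : Disjoint (P₁ ∪ P₂) P₃ := by
    rw [Set.disjoint_left]
    rintro _ (⟨u, -, rfl⟩ | ⟨b, -, rfl⟩) ⟨v, -, h⟩ <;> simp at h
  have hcard := hf.1.ncard_le_card_sub_card (P₁ ∪ P₂ ∪ P₃) (by
    intro x hx
    refine ⟨apex, by simp [P₁, P₂, P₃], ?_⟩
    rcases hx with (⟨u, -, rfl⟩ | ⟨b, hb, rfl⟩) | ⟨u, hu, rfl⟩
    · exact (hA u).symm
    · exact hb.symm
    · exact (hd u hu).symm)
  rw [Set.ncard_union_eq h₁₂₃, Set.ncard_union_eq h₁₂, h₁, h₂, h₃] at hcard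
  refine ⟨S ∪ c '' U, ?_, fun u => ?_⟩
  · have := Set.ncard_union_le S (c '' U)
    have := Set.ncard_image_le (f := c) U.toFinite
    omega
  · by_cases hu : u ∈ U
    · exact ⟨c u, Or.inr ⟨u, hu, rfl⟩, hcE u⟩
    · simp only [U, Set.mem_ofPred_eq, not_forall, not_not] at hu
      obtain ⟨b, hb, hE⟩ := hu
      exact ⟨b, Or.inl hb, hE⟩
end

section
/- Let G be a bipartite graph with parts A and B such that every vertex of A has a neighbor in B, let t be a positive integer with t ≤ |A|, set k = |A| + t, and let G' be the graph obtained from G by adding a new vertex a adjacent to every vertex of B and, for every u ∈ A, adding k+1 new vertices each adjacent to exactly u and a. Then for every tree T and every T-witness structure W of G' with |V(G')| − |V(T)| ≤ k, some witness set of W contains all the vertices of A ∪ {a}. -/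
open SimpleGraph

/-- In an acyclic graph, two vertices joined by paths of length two have a unique middle vertex. -/
theorem middle_eq_of_isAcyclic {W : Type} {T : SimpleGraph W} (hT : T.IsAcyclic) {p q m n : W}
    (hpq : p ≠ q) (hpm : T.Adj p m) (hmq : T.Adj m q) (hpn : T.Adj p n) (hnq : T.Adj n q) :
    m = n := by
  have h := (hT.subsingleton_path _ _).elim
    ⟨.cons hpm (.cons hmq .nil), by simp [hpq, hpm.ne, hmq.ne]⟩
    ⟨.cons hpn (.cons hnq .nil), by simp [hpq, hpn.ne, hnq.ne]⟩
  have h' := congrArg (fun w => w.1.support) h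
  simpa using h'

/-- An acyclic graph has no triangles. -/
theorem not_adj_of_isAcyclic {W : Type} {T : SimpleGraph W} (hT : T.IsAcyclic) {p q m : W}
    (hpm : T.Adj p m) (hmq : T.Adj m q) : ¬ T.Adj p q := by
  intro hpq
  have h := (hT.subsingleton_path _ _).elim
    ⟨.cons hpm (.cons hmq .nil), by simp [hpq.ne, hpm.ne, hmq.ne]⟩
    ⟨.cons hpq .nil, by simp [hpq.ne]⟩
  have h' := congrArg (fun w => w.1.length) h
  simp at h'

/-- A vertex sharing its witness set with another vertex has a neighbor in that set. -/
theorem IsWitnessStructure.exists_adj_s16 {V W : Type} {G : SimpleGraph V} {H : SimpleGraph W}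
    {f : V → W} (hf : IsWitnessStructure G H f) {x y : V} (hxy : x ≠ y) (h : f x = f y) :
    ∃ z, G.Adj x z ∧ f z = f x := by
  obtain ⟨w⟩ := (hf.2.1 (f x)).preconnected ⟨x, rfl⟩ ⟨y, h.symm⟩
  cases w with
  | nil => exact absurd rfl hxy
  | @cons _ v _ hv _ => exact ⟨v.1, hv, v.2⟩

/-- Adjacent vertices in distinct witness sets have adjacent images. -/
theorem IsWitnessStructure.adj_map {V W : Type} {G : SimpleGraph V} {H : SimpleGraph W}
    {f : V → W} (hf : IsWitnessStructure G H f) {x y : V} (h : G.Adj x y) (hne : f x ≠ f y) :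
    H.Adj (f x) (f y) :=
  (hf.2.2 _ _ hne).2 ⟨x, y, rfl, rfl, h⟩

theorem gadget_adj_middle_iff {α β : Type} (E : α → β → Prop) (k : ℕ) (u : α) (i : Fin (k + 1))
    (z : GadgetVertex α β k) :
    (gadget E k).Adj (Sum.inr (Sum.inr (Sum.inr (u, i)))) z ↔
      z = Sum.inl u ∨ z = Sum.inr (Sum.inr (Sum.inl ())) := by
  rcases z with v | b | ⟨⟩ | ⟨v, j⟩ <;> simp [gadget]

/-- The middle vertices between `u` and `a` are absorbed by the witness sets of `u` and `a`. -/
theorem middle_mem_of_isAcyclic {α β : Type} {E : α → β → Prop} {k : ℕ} (hk : 1 ≤ k)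
    {W : Type} {T : SimpleGraph W} (hT : T.IsAcyclic) {f : GadgetVertex α β k → W}
    (hf : IsWitnessStructure (gadget E k) T f) {u : α}
    (hua : f (Sum.inl u) ≠ f (Sum.inr (Sum.inr (Sum.inl ())))) (i : Fin (k + 1)) :
    f (Sum.inr (Sum.inr (Sum.inr (u, i)))) = f (Sum.inl u) ∨
      f (Sum.inr (Sum.inr (Sum.inr (u, i)))) = f (Sum.inr (Sum.inr (Sum.inl ()))) := by
  by_contra! hi
  have hadj_u (j) := (gadget_adj_middle_iff E k u j _).2 (.inl rfl)
  have hadj_a (j) := (gadget_adj_middle_iff E k u j _).2 (.inr rfl)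
  have hui := (hf.adj_map (hadj_u i) hi.1).symm
  have hia := hf.adj_map (hadj_a i) hi.2
  have : Nontrivial (Fin (k + 1)) := Fin.nontrivial_iff_two_le.2 (by omega)
  obtain ⟨j, hji⟩ := exists_ne i
  by_cases hj₁ : f (Sum.inr (Sum.inr (Sum.inr (u, j)))) = f (Sum.inl u)
  · exact not_adj_of_isAcyclic hT hui hia (hj₁ ▸ hf.adj_map (hadj_a j) (hj₁ ▸ hua))
  by_cases hj₂ : f (Sum.inr (Sum.inr (Sum.inr (u, j)))) = f (Sum.inr (Sum.inr (Sum.inl ())))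
  · exact not_adj_of_isAcyclic hT hui hia
      (hj₂ ▸ (hf.adj_map (hadj_u j) (hj₂ ▸ hua.symm)).symm)
  have hij := middle_eq_of_isAcyclic hT hua hui hia (hf.adj_map (hadj_u j) hj₁).symm
    (hf.adj_map (hadj_a j) hj₂)
  obtain ⟨z, hz, hfz⟩ := hf.exists_adj_s16 (by simpa using hji.symm) hij
  rcases (gadget_adj_middle_iff E k u i z).1 hz with rfl | rfl
  · exact hi.1 hfz.symm
  · exact hi.2 hfz.symm

/-- A surjection that is already onto from the complement of the range of an injection `m` has
codomain smaller by at least the size of the domain of `m`. -/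
theorem card_add_card_le_of_surjOn_compl {V W ι : Type} [Finite V] (f : V → W) (m : ι → V)
    (hm : Function.Injective m) (h : ∀ w, ∃ x, x ∉ Set.range m ∧ f x = w) :
    Nat.card W + Nat.card ι ≤ Nat.card V := by
  choose g hg hfg using h
  have : Finite ι := Finite.of_injective m hm
  have : Finite W := Finite.of_injective g (Function.LeftInverse.injective hfg)
  rw [← Nat.card_sum]
  exact Nat.card_le_card_of_injective (Sum.elim g m)
    ((Function.LeftInverse.injective hfg).sumElim hm fun w i h => hg w ⟨i, h.symm⟩)

theorem stmt16 {α β : Type} [Finite α] [Finite β] (E : α → β → Prop)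
    (hE : ∀ u : α, ∃ b : β, E u b) (t : ℕ) (ht : 1 ≤ t) (htA : t ≤ Nat.card α)
    (k : ℕ) (hk : k = Nat.card α + t)
    {W : Type} [Finite W] (T : SimpleGraph W) (hT : T.IsTree)
    (f : GadgetVertex α β k → W) (hf : IsWitnessStructure (gadget E k) T f)
    (hcard : Nat.card (GadgetVertex α β k) - Nat.card W ≤ k) :
    ∃ w : W, (∀ u : α, f (Sum.inl u) = w) ∧
      f (Sum.inr (Sum.inr (Sum.inl ()))) = w := by
  refine ⟨_, fun u => ?_, rfl⟩
  by_contra hua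
  have hmid := middle_mem_of_isAcyclic (by omega) hT.isAcyclic hf hua
  have hle := card_add_card_le_of_surjOn_compl f
    (fun i : Fin (k + 1) => (Sum.inr (Sum.inr (Sum.inr (u, i))) : GadgetVertex α β k))
    (fun i j h => by simpa using h) fun w => by
      obtain ⟨x, rfl⟩ := hf.1 w
      by_cases hx : x ∈ Set.range
          fun i : Fin (k + 1) => (Sum.inr (Sum.inr (Sum.inr (u, i))) : GadgetVertex α β k)
      · obtain ⟨i, rfl⟩ := hx
        rcases hmid i with h | h
        · exact ⟨_, by simp, h.symm⟩
        · exact ⟨_, by simp, h.symm⟩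
      · exact ⟨x, hx, rfl⟩
  rw [Nat.card_eq_fintype_card (α := Fin (k + 1)), Fintype.card_fin] at hle
  omega
end
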